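/- arXiv:1905.13371 — 7 statements merged into one kernel-verified Lean document; each statement's English description precedes it below -/
import Mathlib

section
/- Suppose that B = B* ∩ V is a parity base and that there exist dual variables p and q satisfying (DF1), (DF2), (DF3) together with the blossom conditions (BT1) and (BT2). Then B is a minimum-weight parity base, i.e., the sum of w_ℓ over lines ℓ contained in B is at most the sum of w_ℓ over lines ℓ contained in B' for every parity base B'. -/
open Matrix

/-- A matrix whose row and column index types may differ is *nonsingular* if there is an
index bijection under which its determinant is nonzero.  (This forces the two index sets
to have the same cardinality; the empty matrix is nonsingular by convention.) -/
def Matrix.Nonsing {K : Type*} [CommRing K] {α β : Type*} [Fintype α] [Fintype β]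
    [DecidableEq α] (M : Matrix α β K) : Prop :=
  ∃ e : α ≃ β, (M.submatrix id e).det ≠ 0

/-- The inclusion map between the coercions of two finsets, one contained in the other. -/
def Finset.incl {V : Type*} {P Q : Finset V} (h : P ⊆ Q) (x : ↥P) : ↥Q := ⟨x.1, h x.2⟩

/-- The submatrix `C[X] = C[X ∩ B, X ∖ B]` of a matrix `C` with row set `B` and column
set `V ∖ B`. -/
def csub {K W : Type*} [CommRing K] [Fintype W] [DecidableEq W] (Bs : Finset W)
    (Cs : Matrix ↥Bs ↥(Bsᶜ) K) (X : Finset W) : Matrix ↥(X ∩ Bs) ↥(X \ Bs) K :=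
  Cs.submatrix (Finset.incl Finset.inter_subset_right)
    (Finset.incl (by intro a ha; exact Finset.mem_compl.mpr (Finset.mem_sdiff.mp ha).2))

/-- The pair `(u, v)` of distinct vertices *crosses* the set `Hi` if exactly one of
`u, v` belongs to `Hi`. -/
def crosses {W : Type*} [DecidableEq W] (Hi : Finset W) (u v : W) : Prop :=
  (u ∈ Hi ∧ v ∉ Hi) ∨ (v ∈ Hi ∧ u ∉ Hi)

instance {W : Type*} [DecidableEq W] (Hi : Finset W) (u v : W) :
    Decidable (crosses Hi u v) :=
  inferInstanceAs (Decidable ((u ∈ Hi ∧ v ∉ Hi) ∨ (v ∈ Hi ∧ u ∉ Hi)))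

/-- `Q_{uv}`: the sum of `q (H i)` over all blossoms `H i` crossed by the pair
`(u, v)`. -/
def Qsum {W I : Type*} [DecidableEq W] [Fintype I] (H : I → Finset W) (q : I → ℝ)
    (u v : W) : ℝ :=
  ∑ i ∈ Finset.univ.filter (fun i => crosses (H i) u v), q i

/-- Dual feasibility condition (DF2): `p v − p u ≥ Q_{uv}` for every `(u, v) ∈ F*`,
i.e. for every `u ∈ B*`, `v ∈ V* ∖ B*` with `C*_{uv} ≠ 0`. -/
def DF2 {K W I : Type*} [Field K] [Fintype W] [DecidableEq W] [Fintype I]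
    (Bs : Finset W) (Cs : Matrix ↥Bs ↥(Bsᶜ) K) (H : I → Finset W) (q : I → ℝ)
    (p : W → ℝ) : Prop :=
  ∀ (u : ↥Bs) (v : ↥(Bsᶜ)), Cs u v ≠ 0 → Qsum H q u.1 v.1 ≤ p v.1 - p u.1

/-- `C'` is the matrix obtained from `Cs` (with row set `Bs` and column set `Bsᶜ`) by
*pivoting around* `X`: writing `Cs = [[α, β], [γ, δ]]` with `α = Cs[X∩Bs, X∖Bs]`,
`β = Cs[X∩Bs, Bsᶜ∖X]`, `γ = Cs[Bs∖X, X∖Bs]`, `δ = Cs[Bs∖X, Bsᶜ∖X]`, the matrix `C'`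
(with row set `Bs △ X` and column set `(Bs △ X)ᶜ`) has blocks
`C'[X∖Bs, X∩Bs] = α⁻¹`, `C'[X∖Bs, Bsᶜ∖X] = α⁻¹β`, `C'[Bs∖X, X∩Bs] = −γα⁻¹`, and
`C'[Bs∖X, Bsᶜ∖X] = δ − γα⁻¹β`. -/
def IsPivot {K W : Type*} [Field K] [Fintype W] [DecidableEq W] (Bs X : Finset W)
    (Cs : Matrix ↥Bs ↥(Bsᶜ) K)
    (C' : Matrix ↥(symmDiff Bs X) ↥((symmDiff Bs X)ᶜ) K) : Prop :=
  let hXB : X ∩ Bs ⊆ Bs := Finset.inter_subset_right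
  let hXBc : X \ Bs ⊆ Bsᶜ := by
    intro a ha; exact Finset.mem_compl.mpr (Finset.mem_sdiff.mp ha).2
  let hBX : Bs \ X ⊆ Bs := Finset.sdiff_subset
  let hBcX : Bsᶜ \ X ⊆ Bsᶜ := Finset.sdiff_subset
  let hr1 : X \ Bs ⊆ symmDiff Bs X := by
    intro a ha; rw [Finset.mem_symmDiff]
    exact Or.inr ⟨(Finset.mem_sdiff.mp ha).1, (Finset.mem_sdiff.mp ha).2⟩
  let hr2 : Bs \ X ⊆ symmDiff Bs X := by
    intro a ha; rw [Finset.mem_symmDiff]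
    exact Or.inl ⟨(Finset.mem_sdiff.mp ha).1, (Finset.mem_sdiff.mp ha).2⟩
  let hc1 : X ∩ Bs ⊆ (symmDiff Bs X)ᶜ := by
    intro a ha
    rw [Finset.mem_inter] at ha
    rw [Finset.mem_compl, Finset.mem_symmDiff]
    push_neg
    exact ⟨fun _ => ha.1, fun _ => ha.2⟩
  let hc2 : Bsᶜ \ X ⊆ (symmDiff Bs X)ᶜ := by
    intro a ha
    rw [Finset.mem_sdiff, Finset.mem_compl] at ha
    rw [Finset.mem_compl, Finset.mem_symmDiff]
    push_neg
    exact ⟨fun h => absurd h ha.1, fun h => absurd h ha.2⟩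
  let α := Cs.submatrix (Finset.incl hXB) (Finset.incl hXBc)
  let β := Cs.submatrix (Finset.incl hXB) (Finset.incl hBcX)
  let γ := Cs.submatrix (Finset.incl hBX) (Finset.incl hXBc)
  let δ := Cs.submatrix (Finset.incl hBX) (Finset.incl hBcX)
  let C11 := C'.submatrix (Finset.incl hr1) (Finset.incl hc1)
  let C12 := C'.submatrix (Finset.incl hr1) (Finset.incl hc2)
  let C21 := C'.submatrix (Finset.incl hr2) (Finset.incl hc1)
  let C22 := C'.submatrix (Finset.incl hr2) (Finset.incl hc2)
  α * C11 = 1 ∧ C11 * α = 1 ∧ α * C12 = β ∧ C21 * α = -γ ∧ C22 = δ - γ * C12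

/-- `B` is a base of the column matroid of `A`: `|B| = |U|` and `A[U,B]` is
nonsingular. -/
def Matrix.IsBase {K U V : Type*} [CommRing K] [Fintype U] [Fintype V] [DecidableEq U]
    (A : Matrix U V K) (B : Finset V) : Prop :=
  Matrix.Nonsing (A.submatrix id (fun b : ↥B => (b : V)))

/-- The vertex set `V* = V ∪ T`: the column set `V = L × Bool` (the line of `ℓ ∈ L`
consists of the mates `(ℓ, false)` and `(ℓ, true)`) together with the buds and tips
`T = {b i, t i : i < λ}` of the `λ` blossoms, all distinct and disjoint from `V`. -/
abbrev VStar (L : Type*) (lam : ℕ) := (L × Bool) ⊕ (Fin lam × Bool)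

/-- The bud `b i` of the `i`-th blossom. -/
def bud {L : Type*} {lam : ℕ} (i : Fin lam) : VStar L lam := Sum.inr (i, false)

/-- The tip `t i` of the `i`-th blossom. -/
def tip {L : Type*} {lam : ℕ} (i : Fin lam) : VStar L lam := Sum.inr (i, true)

/-- The set `T = {b i, t i : i < λ}` of all buds and tips. -/
def Tset (L : Type*) [Fintype L] [DecidableEq L] (lam : ℕ) : Finset (VStar L lam) :=
  Finset.univ.map ⟨Sum.inr, Sum.inr_injective⟩

/-- The extension by zero of a matrix indexed by two finsets. -/
def Matrix.extendZero {K W : Type*} [Zero K] [DecidableEq W] {P Q : Finset W}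
    (M : Matrix ↥P ↥Q K) (u v : W) : K :=
  if h : u ∈ P ∧ v ∈ Q then M ⟨u, h.1⟩ ⟨v, h.2⟩ else 0

lemma Matrix.extendZero_apply {K W : Type*} [Zero K] [DecidableEq W] {P Q : Finset W}
    (M : Matrix ↥P ↥Q K) {u v : W} (hu : u ∈ P) (hv : v ∈ Q) :
    M.extendZero u v = M ⟨u, hu⟩ ⟨v, hv⟩ :=
  dif_pos ⟨hu, hv⟩

/-- A square array with trivial kernel has a transversal of nonzero entries. -/
lemma exists_equiv_forall_ne_zero {K W : Type*} [Field K] [DecidableEq W]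
    {R S : Finset W} (hcard : R.card = S.card) (c : W → W → K)
    (hker : ∀ x : W → K, (∀ u ∈ R, ∑ s ∈ S, c u s * x s = 0) → ∀ s ∈ S, x s = 0) :
    ∃ e : ↥R ≃ ↥S, ∀ u : ↥R, c u (e u) ≠ 0 := by
  obtain ⟨e⟩ : Nonempty (↥R ≃ ↥S) := ⟨Finset.equivOfCardEq hcard⟩
  let M : Matrix ↥R ↥R K := fun u v => c u (e v)
  have hdet : M.det ≠ 0 := by
    intro h0
    obtain ⟨y, hy, hMy⟩ := Matrix.exists_mulVec_eq_zero_iff.mpr h0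
    let x : W → K := fun s => if h : s ∈ S then y (e.symm ⟨s, h⟩) else 0
    have hx : ∀ s : ↥S, x s = y (e.symm s) := fun s => by simp [x]
    refine hy (funext fun v => ?_)
    have h := hker x (fun u hu => ?_) (e v) (e v).2
    · simpa [hx] using h
    · have h := congrFun hMy ⟨u, hu⟩
      rw [← Finset.sum_coe_sort S (fun s => c u s * x s), ← e.sum_comp]
      simpa [hx, M, Matrix.mulVec, dotProduct] using h
  rw [Matrix.det_apply] at hdet
  obtain ⟨σ, -, hσ⟩ := Finset.exists_ne_zero_of_sum_ne_zero hdet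
  have hprod : ∏ u, M (σ u) u ≠ 0 := fun h => hσ (by rw [h, smul_zero])
  refine ⟨σ.symm.trans e, fun u => ?_⟩
  simpa [M] using Finset.prod_ne_zero_iff.mp hprod (σ.symm u) (Finset.mem_univ _)

namespace IsPivot

variable {K W : Type*} [Field K] [Fintype W] [DecidableEq W] {Bs X : Finset W}
  {Cs : Matrix ↥Bs ↥(Bsᶜ) K} {C' : Matrix ↥(symmDiff Bs X) ↥((symmDiff Bs X)ᶜ) K}

lemma sum_mul_eq (h : IsPivot Bs X Cs C') {u y : W} (hu : u ∈ X ∩ Bs) (hy : y ∈ Bsᶜ \ X) :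
    ∑ v ∈ X \ Bs, Cs.extendZero u v * C'.extendZero v y = Cs.extendZero u y := by
  have h12 := congrFun (congrFun h.2.2.1 ⟨u, hu⟩) ⟨y, hy⟩
  rw [← Finset.sum_coe_sort]
  simp only [Finset.mem_inter, Finset.mem_sdiff, Finset.mem_compl] at hu hy
  rw [Matrix.extendZero_apply Cs hu.2 (by simpa using hy.1)]
  refine Eq.trans (Finset.sum_congr rfl fun v _ => ?_) h12
  have hv := Finset.mem_sdiff.mp v.2
  rw [Matrix.extendZero_apply Cs hu.2 (by simpa using hv.2),
    Matrix.extendZero_apply C' (by simp [Finset.mem_symmDiff, hv])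
      (by simp [hy])]
  rfl

lemma eq_sub_sum (h : IsPivot Bs X Cs C') {u y : W} (hu : u ∈ Bs \ X) (hy : y ∈ Bsᶜ \ X) :
    C'.extendZero u y =
      Cs.extendZero u y - ∑ v ∈ X \ Bs, Cs.extendZero u v * C'.extendZero v y := by
  have h22 := congrFun (congrFun h.2.2.2.2 ⟨u, hu⟩) ⟨y, hy⟩
  rw [← Finset.sum_coe_sort]
  simp only [Finset.mem_sdiff, Finset.mem_compl] at hu hy
  rw [Matrix.extendZero_apply Cs hu.1 (by simpa using hy.1),
    Matrix.extendZero_apply C' (by simp [Finset.mem_symmDiff, hu])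
      (by simp [hy])]
  refine Eq.trans h22 (congrArg _ (Finset.sum_congr rfl fun v _ => ?_))
  have hv := Finset.mem_sdiff.mp v.2
  rw [Matrix.extendZero_apply Cs hu.1 (by simpa using hv.2),
    Matrix.extendZero_apply C' (by simp [Finset.mem_symmDiff, hv])
      (by simp [hy])]
  rfl

lemma eq_zero_of_sum_eq_zero (h : IsPivot Bs X Cs C') {x : W → K}
    (hx : ∀ u ∈ X ∩ Bs, ∑ v ∈ X \ Bs, Cs.extendZero u v * x v = 0) :
    ∀ v ∈ X \ Bs, x v = 0 := by
  intro v hv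
  let y : ↥(X \ Bs) → K := fun v => x v
  have hy := congrArg (· *ᵥ y) h.2.1
  simp only [← Matrix.mulVec_mulVec, Matrix.one_mulVec] at hy
  refine (congrFun hy ⟨v, hv⟩).symm.trans ?_
  refine (congrFun (congrArg _ (funext fun u => ?_)) _).trans (congrFun (Matrix.mulVec_zero _) _)
  refine Eq.trans ?_ (hx u u.2)
  rw [← Finset.sum_coe_sort]
  refine Finset.sum_congr rfl fun v _ => ?_
  rw [Matrix.extendZero_apply Cs (Finset.mem_inter.mp u.2).2
    (by simpa using (Finset.mem_sdiff.mp v.2).2)]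
  rfl

/-- If the pivoted matrix has trivial kernel on `Z`, then the original matrix has trivial kernel
on `X ∪ Z`. -/
lemma ker_union (h : IsPivot Bs X Cs C') {Z : Finset W} (hXZ : Disjoint X Z)
    (hZ : ∀ x : W → K, (∀ u ∈ Z ∩ Bs, ∑ v ∈ Z \ Bs, C'.extendZero u v * x v = 0) →
      ∀ v ∈ Z \ Bs, x v = 0)
    (x : W → K)
    (hx : ∀ u ∈ (X ∪ Z) ∩ Bs, ∑ v ∈ (X ∪ Z) \ Bs, Cs.extendZero u v * x v = 0) :
    ∀ v ∈ (X ∪ Z) \ Bs, x v = 0 := by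
  have hsplit : ∀ f : W → K, ∑ v ∈ (X ∪ Z) \ Bs, f v = ∑ v ∈ X \ Bs, f v + ∑ v ∈ Z \ Bs, f v := by
    intro f
    rw [Finset.union_sdiff_distrib, Finset.sum_union
      (hXZ.mono Finset.sdiff_subset Finset.sdiff_subset)]
  have hZX : ∀ {v}, v ∈ Z → v ∉ X := fun hv hvX => Finset.disjoint_left.mp hXZ hvX hv
  have hcol : ∀ {v}, v ∈ Z \ Bs → v ∈ Bsᶜ \ X := fun hv => by
    rw [Finset.mem_sdiff] at hv
    simp [hv.2, hZX hv.1]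
  simp only [hsplit] at hx
  have hX : ∀ v ∈ X \ Bs, x v + ∑ z ∈ Z \ Bs, C'.extendZero v z * x z = 0 := by
    refine h.eq_zero_of_sum_eq_zero (x := fun v => x v + ∑ z ∈ Z \ Bs, C'.extendZero v z * x z)
      fun u hu => ?_
    rw [← hx u (by rw [Finset.mem_inter] at hu ⊢; exact ⟨Finset.mem_union_left _ hu.1, hu.2⟩)]
    simp only [mul_add, Finset.sum_add_distrib, Finset.mul_sum]
    rw [Finset.sum_comm]
    congr 1
    refine Finset.sum_congr rfl fun z hz => ?_
    rw [← h.sum_mul_eq hu (hcol hz), Finset.sum_mul]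
    simp only [mul_assoc]
  have hZ0 : ∀ v ∈ Z \ Bs, x v = 0 := by
    refine hZ x fun u hu => ?_
    rw [Finset.mem_inter] at hu
    have hxu := hx u (Finset.mem_inter.mpr ⟨Finset.mem_union_right _ hu.1, hu.2⟩)
    have hsub : ∑ v ∈ X \ Bs, Cs.extendZero u v * x v =
        -∑ z ∈ Z \ Bs, (∑ v ∈ X \ Bs, Cs.extendZero u v * C'.extendZero v z) * x z := by
      simp only [Finset.sum_mul]
      rw [Finset.sum_comm, ← Finset.sum_neg_distrib]
      refine Finset.sum_congr rfl fun v hv => ?_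
      rw [eq_neg_of_add_eq_zero_left (hX v hv), mul_neg, Finset.mul_sum]
      simp only [mul_assoc]
    rw [← hxu, hsub, neg_add_eq_sub, ← Finset.sum_sub_distrib]
    refine Finset.sum_congr rfl fun z hz => ?_
    rw [h.eq_sub_sum (Finset.mem_sdiff.mpr ⟨hu.2, hZX hu.1⟩) (hcol hz), sub_mul]
  intro v hv
  rw [Finset.union_sdiff_distrib, Finset.mem_union] at hv
  rcases hv with hv | hv
  · have := hX v hv
    rwa [Finset.sum_eq_zero fun z hz => by rw [hZ0 z hz, mul_zero], add_zero] at this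
  · exact hZ0 v hv

end IsPivot

namespace Matrix.IsBase

variable {K U V : Type*} [Field K] [Fintype U] [Fintype V] [DecidableEq U]
  {A : Matrix U V K} {B : Finset V}

lemma card_eq (h : A.IsBase B) : B.card = Fintype.card U := by
  obtain ⟨e, -⟩ := h
  rw [← Fintype.card_coe, Fintype.card_congr e]

lemma eq_zero_of_sum_eq_zero (h : A.IsBase B) {y : V → K}
    (hy : ∀ u, ∑ b ∈ B, A u b * y b = 0) : ∀ b ∈ B, y b = 0 := by
  obtain ⟨e, he⟩ := h
  have h0 := Matrix.eq_zero_of_mulVec_eq_zero he (v := fun u => y (e u)) <| by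
    funext u
    rw [Pi.zero_apply, ← hy u, ← Finset.sum_coe_sort, ← e.sum_comp]
    rfl
  intro b hb
  simpa using congrFun h0 (e.symm ⟨b, hb⟩)

end Matrix.IsBase

/-- Exchanging bases: if the columns outside `B` are expressed in terms of those in `B` by the
coefficients `c`, then `c` has trivial kernel on `(B \ B') × (B' \ B)` for every base `B'`. -/
lemma Matrix.IsBase.ker_exchange {K U V : Type*} [Field K] [Fintype U] [Fintype V]
    [DecidableEq U] [DecidableEq V] {A : Matrix U V K} {B B' : Finset V} (hB' : A.IsBase B')
    {c : V → V → K} (hc : ∀ u, ∀ v ∉ B, ∑ b ∈ B, A u b * c b v = A u v) {x : V → K}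
    (hx : ∀ b ∈ B \ B', ∑ v ∈ B' \ B, c b v * x v = 0) : ∀ v ∈ B' \ B, x v = 0 := by
  let y : V → K := fun v => if v ∈ B then -∑ z ∈ B' \ B, c v z * x z else x v
  have hy : ∀ b ∈ B', y b = 0 := by
    refine hB'.eq_zero_of_sum_eq_zero fun u => ?_
    have hin : ∑ v ∈ B' ∩ B, A u v * y v = -∑ b ∈ B, A u b * ∑ z ∈ B' \ B, c b z * x z := by
      rw [Finset.inter_comm, ← Finset.sum_neg_distrib, ← Finset.sum_inter_add_sum_sdiff B B']
      rw [Finset.sum_eq_zero (s := B \ B') fun b hb => by rw [hx b hb, mul_zero, neg_zero],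
        add_zero]
      refine Finset.sum_congr rfl fun b hb => ?_
      simp [y, (Finset.mem_inter.mp hb).1]
    have hout : ∑ v ∈ B' \ B, A u v * y v = ∑ b ∈ B, A u b * ∑ z ∈ B' \ B, c b z * x z := by
      simp only [Finset.mul_sum]
      rw [Finset.sum_comm]
      refine Finset.sum_congr rfl fun v hv => ?_
      have hvB := (Finset.mem_sdiff.mp hv).2
      simp only [y, if_neg hvB]
      rw [← hc u v hvB, Finset.sum_mul]
      simp only [mul_assoc]
    rw [← Finset.sum_inter_add_sum_sdiff B' B, hin, hout, neg_add_cancel]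
  intro v hv
  rw [Finset.mem_sdiff] at hv
  simpa [y, hv.2] using hy v hv.1

/-- A perfect matching crosses every set that contains an odd number of matched vertices, so its
total `Qsum` is at least the sum of all `q i`. -/
lemma sum_le_sum_Qsum {W I : Type*} [DecidableEq W] [Fintype I] {H : I → Finset W} {q : I → ℝ}
    (hq : ∀ i, 0 ≤ q i) {R S : Finset W} (e : ↥R ≃ ↥S)
    (hodd : ∀ i, Odd ((R ∩ H i).card + (S ∩ H i).card)) :
    ∑ i, q i ≤ ∑ u : ↥R, Qsum H q u (e u) := by
  have hcross : ∀ i, ∃ u : ↥R, crosses (H i) u (e u) := by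
    intro i
    by_contra! hno
    have hiff : ∀ u : ↥R, (u : W) ∈ H i ↔ (e u : W) ∈ H i := fun u => by
      have := hno u
      unfold crosses at this
      tauto
    have hcard : (R ∩ H i).card = (S ∩ H i).card := by
      refine Finset.card_bij'
        (fun u hu => (e ⟨u, (Finset.mem_inter.mp hu).1⟩ : W))
        (fun v hv => (e.symm ⟨v, (Finset.mem_inter.mp hv).1⟩ : W)) ?_ ?_ ?_ ?_
      · intro u hu
        rw [Finset.mem_inter] at hu
        exact Finset.mem_inter.mpr ⟨(e _).2, (hiff ⟨u, hu.1⟩).mp hu.2⟩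
      · intro v hv
        rw [Finset.mem_inter] at hv
        exact Finset.mem_inter.mpr ⟨(e.symm _).2, (hiff _).mpr (by simpa using hv.2)⟩
      · intro u hu
        simp
      · intro v hv
        simp
    have := hodd i
    rw [hcard, ← two_mul] at this
    exact (Nat.not_odd_iff_even.mpr (even_two_mul _)) this
  simp only [Qsum, Finset.sum_filter]
  rw [Finset.sum_comm]
  refine Finset.sum_le_sum fun i _ => ?_
  obtain ⟨u, hu⟩ := hcross i
  calc q i = if crosses (H i) u (e u) then q i else 0 := (if_pos hu).symm
    _ ≤ _ := Finset.single_le_sum (f := fun u : ↥R => if crosses (H i) u (e u) then q i else 0)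
      (fun v _ => by split_ifs <;> simp [hq i]) (Finset.mem_univ u)

/-- A set closed under the mate involution is a union of lines, so sums over it can be taken line
by line. -/
lemma sum_eq_sum_lines {M L : Type*} [AddCommMonoid M] [Fintype L] [DecidableEq L]
    {B : Finset (L × Bool)} (hB : ∀ x ∈ B, (x.1, !x.2) ∈ B) (f : L × Bool → M) :
    ∑ x ∈ B, f x =
      ∑ ℓ ∈ Finset.univ.filter (fun ℓ : L => (ℓ, true) ∈ B ∧ (ℓ, false) ∈ B),
        (f (ℓ, false) + f (ℓ, true)) := by
  rw [Finset.sum_filter, ← Finset.filter_univ_mem B, Finset.sum_filter, Fintype.sum_prod_type]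
  simp only [Finset.filter_univ_mem]
  refine Finset.sum_congr rfl fun ℓ _ => ?_
  have h1 := hB (ℓ, true)
  have h2 := hB (ℓ, false)
  simp only [Bool.not_true, Bool.not_false] at h1 h2
  by_cases ht : (ℓ, true) ∈ B
  · simp [ht, h1 ht, add_comm]
  · have hf : (ℓ, false) ∉ B := fun hf => ht (h2 hf)
    simp [ht, hf]

lemma even_card_of_lines {L : Type*} [Fintype L] [DecidableEq L]
    {B : Finset (L × Bool)} (hB : ∀ x ∈ B, (x.1, !x.2) ∈ B) : Even B.card := by
  rw [Finset.card_eq_sum_ones, sum_eq_sum_lines hB]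
  exact Finset.even_sum _ fun _ _ => even_two

/-- The part of `B ∆ B'` inside `B*`. -/
lemma map_symmDiff_inter {α β : Type*} [DecidableEq α] [DecidableEq β] {Bs : Finset (α ⊕ β)}
    {B : Finset α} (hB : ∀ x, x ∈ B ↔ Sum.inl x ∈ Bs) (B' : Finset α) :
    (symmDiff B B').map .inl ∩ Bs = (B \ B').map .inl := by
  ext (x | x)
  · simp [Finset.mem_symmDiff, ← hB]
    tauto
  · simp

/-- The part of `B ∆ B'` outside `B*`. -/
lemma map_symmDiff_sdiff {α β : Type*} [DecidableEq α] [DecidableEq β] {Bs : Finset (α ⊕ β)}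
    {B : Finset α} (hB : ∀ x, x ∈ B ↔ Sum.inl x ∈ Bs) (B' : Finset α) :
    (symmDiff B B').map .inl \ Bs = (B' \ B).map .inl := by
  ext (x | x)
  · simp [Finset.mem_symmDiff, ← hB]
    tauto
  · simp

lemma disjoint_Tset_map_inl {L : Type*} [Fintype L] [DecidableEq L] {lam : ℕ}
    (Z : Finset (L × Bool)) : Disjoint (Tset L lam) (Z.map .inl) := by
  simp [Finset.disjoint_left, Tset]

/-- A signed sum over `B ∆ B'` together with all buds and tips. -/
lemma sum_sdiff_sub_sum_inter {L : Type*} [Fintype L] [DecidableEq L] {lam : ℕ}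
    {Bs : Finset (VStar L lam)} {B : Finset (L × Bool)} (hB : ∀ x, x ∈ B ↔ Sum.inl x ∈ Bs)
    (hT : ∀ i : Fin lam, bud i ∈ Bs ↔ tip i ∉ Bs) (B' : Finset (L × Bool))
    (f : VStar L lam → ℝ) :
    ∑ v ∈ (Tset L lam ∪ (symmDiff B B').map .inl) \ Bs, f v -
        ∑ u ∈ (Tset L lam ∪ (symmDiff B B').map .inl) ∩ Bs, f u =
      (∑ x ∈ B', f (.inl x) - ∑ x ∈ B, f (.inl x)) +
        ∑ i : Fin lam, if bud i ∈ Bs then f (tip i) - f (bud i) else f (bud i) - f (tip i) := by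
  let g : VStar L lam → ℝ := fun v => if v ∈ Bs then -f v else f v
  have hg : ∀ P : Finset (VStar L lam), ∑ v ∈ P \ Bs, f v - ∑ u ∈ P ∩ Bs, f u = ∑ v ∈ P, g v := by
    intro P
    rw [← Finset.sum_inter_add_sum_sdiff P Bs, sub_eq_neg_add, ← Finset.sum_neg_distrib]
    congr 1
    · exact Finset.sum_congr rfl fun v hv => (if_pos (Finset.mem_inter.mp hv).2).symm
    · exact Finset.sum_congr rfl fun v hv => (if_neg (Finset.mem_sdiff.mp hv).2).symm
  rw [hg, Finset.sum_union (disjoint_Tset_map_inl _), add_comm]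
  congr 1
  · rw [Finset.sum_map, symmDiff_def, Finset.sup_eq_union,
      Finset.sum_union disjoint_sdiff_sdiff, add_comm,
      ← Finset.sum_sdiff_sub_sum_sdiff, sub_eq_add_neg, ← Finset.sum_neg_distrib]
    congr 1 <;> refine Finset.sum_congr rfl fun x hx => ?_ <;> rw [Finset.mem_sdiff, hB] at hx
    · simp [g, hx.2]
    · simp [g, hx.1]
  · rw [Tset, Finset.sum_map, Fintype.sum_prod_type]
    refine Finset.sum_congr rfl fun i _ => ?_
    have := hT i
    simp only [bud, tip] at this ⊢
    by_cases hb : (Sum.inr (i, false) : VStar L lam) ∈ Bs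
    · have ht := this.mp hb
      simp [g, hb, ht, sub_eq_add_neg]
    · have ht : (Sum.inr (i, true) : VStar L lam) ∈ Bs := by tauto
      simp [g, hb, ht, sub_eq_neg_add]

/-- A blossom contains an odd number of buds and tips, hence an odd number of elements of
`T ∪ Z` for every union of lines `Z`. -/
lemma odd_card_inter_blossom {L : Type*} [Fintype L] [DecidableEq L] {lam : ℕ}
    {H : Fin lam → Finset (VStar L lam)} {i : Fin lam} {Z : Finset (L × Bool)}
    (hZ : ∀ x ∈ Z, (x.1, !x.2) ∈ Z)
    (hline : ∀ x : L × Bool, Sum.inl x ∈ H i → Sum.inl (x.1, !x.2) ∈ H i)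
    (htip : tip i ∈ H i) (hbud : bud i ∉ H i)
    (hmem : ∀ j, j ≠ i → (tip j ∈ H i ↔ bud j ∈ H i)) :
    Odd ((Tset L lam ∪ Z.map .inl) ∩ H i).card := by
  rw [Finset.union_inter_distrib_right, Finset.card_union_of_disjoint
    ((disjoint_Tset_map_inl Z).mono Finset.inter_subset_left Finset.inter_subset_left)]
  refine Odd.add_even ?_ ?_
  · rw [← Finset.filter_mem_eq_inter, Finset.card_filter, Tset, Finset.sum_map,
      Fintype.sum_prod_type, Fintype.sum_eq_add_sum_compl i]
    simp only [bud, tip] at htip hbud hmem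
    refine Odd.add_even (by simp [Finset.filter_insert, Finset.filter_singleton, htip, hbud])
      (Finset.even_sum _ fun j hj => ?_)
    have := hmem j (by simpa using hj)
    by_cases hb : Sum.inr (j, false) ∈ H i <;>
      simp [Finset.filter_insert, Finset.filter_singleton, this, hb]
  · have : Z.map .inl ∩ H i = (Z.filter (fun x => Sum.inl x ∈ H i)).map .inl := by
      ext v
      simp only [Finset.mem_inter, Finset.mem_map, Finset.mem_filter]
      constructor
      · rintro ⟨⟨x, hx, rfl⟩, hv⟩
        exact ⟨x, ⟨hx, hv⟩, rfl⟩
      · rintro ⟨x, ⟨hx, hv⟩, rfl⟩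
        exact ⟨⟨x, hx, rfl⟩, hv⟩
    rw [this, Finset.card_map]
    refine even_card_of_lines fun x hx => ?_
    rw [Finset.mem_filter] at hx ⊢
    exact ⟨hZ x hx.1, hline x hx.2⟩

/-- **Optimality of a parity base admitting feasible dual variables (Theorem 6.1).**
Let `A` be a full-row-rank matrix over a field `K` with column set `V = L × Bool`
partitioned into lines with weights `w : L → ℝ`.  Suppose the blossoms
`H 0, …, H (λ−1) ⊆ V*` (with buds `bud i ∉ H i`, tips `tip i ∈ H i`), the set
`B* ⊆ V*` with `B* ∩ V = B` and `|B* ∩ {bud i, tip i}| = 1`, and the matrix `C*`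
satisfy the structural conditions (laminarity, nonempty line-closed `H i ∩ V`,
distinctness, bud/tip membership) together with (BT1) and (BT2), and that the dual
variables `p : V* → ℝ`, `q ≥ 0` satisfy (DF1)–(DF3).  If `B = B* ∩ V` is a parity
base, then `B` is a minimum-weight parity base: for every parity base `B'`,
`Σ_{ℓ ⊆ B} w ℓ ≤ Σ_{ℓ ⊆ B'} w ℓ`. -/
theorem parityBase_min_of_dualFeasible {K U L : Type*} [Field K] [Fintype U] [Fintype L]
    [DecidableEq U] [DecidableEq L]
    (A : Matrix U (L × Bool) K) (hrank : A.rank = Fintype.card U)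
    (w : L → ℝ) (lam : ℕ)
    (H : Fin lam → Finset (VStar L lam))
    (Bstar : Finset (VStar L lam))
    (B : Finset (L × Bool))
    (hB : ∀ x : L × Bool, x ∈ B ↔ Sum.inl x ∈ Bstar)
    (Cs : Matrix ↥Bstar ↥(Bstarᶜ) K)
    (p : VStar L lam → ℝ) (q : Fin lam → ℝ)
    -- structure of the blossoms
    (hHne : ∀ i, ∃ x : L × Bool, Sum.inl x ∈ H i)
    (hHline : ∀ i (x : L × Bool), Sum.inl x ∈ H i → Sum.inl (x.1, !x.2) ∈ H i)
    (htip : ∀ i, tip i ∈ H i)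
    (hbud : ∀ i, bud i ∉ H i)
    (htipmem : ∀ i j, j ≠ i → (tip j ∈ H i ↔ H j ⊆ H i))
    (hbudmem : ∀ i j, j ≠ i → (bud j ∈ H i ↔ H j ⊂ H i))
    (hlaminar : ∀ i j : Fin lam, i < j → Disjoint (H i) (H j) ∨ H i ⊂ H j)
    (hdistinct : ∀ i j, i ≠ j →
      (Finset.univ.filter fun x : L × Bool => Sum.inl x ∈ H i) ≠
        (Finset.univ.filter fun x : L × Bool => Sum.inl x ∈ H j))
    (hBstarT : ∀ i : Fin lam, bud i ∈ Bstar ↔ tip i ∉ Bstar)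
    -- (BT1): pivoting `C*` around `T` yields the fundamental cocircuit matrix w.r.t. `B`
    (hBT1 : Matrix.Nonsing (csub Bstar Cs (Tset L lam)) ∧
      ∃ C' : Matrix ↥(symmDiff Bstar (Tset L lam)) ↥((symmDiff Bstar (Tset L lam))ᶜ) K,
        IsPivot Bstar (Tset L lam) Cs C' ∧
        ∀ (u : U) (x : L × Bool) (hx : x ∉ B),
          ∑ b ∈ B.attach, A u b.1 *
            C' ⟨Sum.inl b.1, by
                  rw [Finset.mem_symmDiff]
                  refine Or.inl ⟨(hB b.1).mp b.2, ?_⟩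
                  simp [Tset]⟩
               ⟨Sum.inl x, by
                  rw [Finset.mem_compl, Finset.mem_symmDiff]
                  push_neg
                  constructor
                  · intro h; exact absurd ((hB x).mpr h) hx
                  · intro h; exact absurd h (by simp [Tset])⟩ = A u x)
    -- (BT2), case `bud i ∈ B*`, `tip i ∈ V* ∖ B*`
    (hBT2 : ∀ (i : Fin lam) (hbi : bud i ∈ Bstar) (hti : tip i ∈ Bstarᶜ),
      Cs ⟨bud i, hbi⟩ ⟨tip i, hti⟩ ≠ 0 ∧
      (∀ v : ↥(Bstarᶜ), v.1 ∈ H i → v.1 ≠ tip i → Cs ⟨bud i, hbi⟩ v = 0) ∧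
      (∀ u : ↥Bstar, u.1 ∉ H i → u.1 ≠ bud i → Cs u ⟨tip i, hti⟩ = 0))
    -- (BT2), case `bud i ∈ V* ∖ B*`, `tip i ∈ B*`
    (hBT2' : ∀ (i : Fin lam) (hbi : bud i ∈ Bstarᶜ) (hti : tip i ∈ Bstar),
      Cs ⟨tip i, hti⟩ ⟨bud i, hbi⟩ ≠ 0 ∧
      (∀ u : ↥Bstar, u.1 ∈ H i → u.1 ≠ tip i → Cs u ⟨bud i, hbi⟩ = 0) ∧
      (∀ v : ↥(Bstarᶜ), v.1 ∉ H i → v.1 ≠ bud i → Cs ⟨tip i, hti⟩ v = 0))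
    -- dual feasibility (DF1)--(DF3), with `q ≥ 0`
    (hq : ∀ i, 0 ≤ q i)
    (hDF1 : ∀ ℓ : L, p (Sum.inl (ℓ, false)) + p (Sum.inl (ℓ, true)) = w ℓ)
    (hDF2 : ∀ (u : ↥Bstar) (v : ↥(Bstarᶜ)), Cs u v ≠ 0 →
      Qsum H q u.1 v.1 ≤ p v.1 - p u.1)
    (hDF3 : ∀ (i : Fin lam) (u : ↥Bstar) (v : ↥(Bstarᶜ)), Cs u v ≠ 0 →
      ({u.1, v.1} : Finset (VStar L lam)) = {bud i, tip i} → p v.1 - p u.1 = q i)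
    -- `B = B* ∩ V` is a parity base
    (hbase : A.IsBase B) (hparity : ∀ x ∈ B, (x.1, !x.2) ∈ B) :
    -- conclusion: `B` is a minimum-weight parity base
    ∀ B' : Finset (L × Bool), A.IsBase B' → (∀ x ∈ B', (x.1, !x.2) ∈ B') →
      ∑ ℓ ∈ Finset.univ.filter (fun ℓ : L => (ℓ, true) ∈ B ∧ (ℓ, false) ∈ B), w ℓ ≤
        ∑ ℓ ∈ Finset.univ.filter (fun ℓ : L => (ℓ, true) ∈ B' ∧ (ℓ, false) ∈ B'), w ℓ := by
  intro B' hB' hpar'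
  obtain ⟨-, C', hpiv, hC'⟩ := hBT1
  set Z : Finset (VStar L lam) := (symmDiff B B').map .inl
  have hexp : ∀ u, ∀ x ∉ B,
      ∑ b ∈ B, A u b * C'.extendZero (Sum.inl b) (Sum.inl x) = A u x := by
    intro u x hx
    rw [← hC' u x hx, ← Finset.sum_attach]
    refine Finset.sum_congr rfl fun b _ => ?_
    rw [Matrix.extendZero_apply]
  have hsigned := sum_sdiff_sub_sum_inter hB hBstarT B'
  obtain ⟨e, he⟩ := exists_equiv_forall_ne_zero (R := (Tset L lam ∪ Z) ∩ Bstar)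
    (S := (Tset L lam ∪ Z) \ Bstar) (by
      have h := hsigned fun _ => 1
      simp only [Finset.sum_const, nsmul_eq_mul, mul_one, sub_self, ite_self, mul_zero,
        add_zero, hbase.card_eq, hB'.card_eq] at h
      exact_mod_cast (sub_eq_zero.mp h).symm)
    Cs.extendZero (hpiv.ker_union (disjoint_Tset_map_inl _) fun x hx => by
      rw [map_symmDiff_inter hB] at hx
      rw [map_symmDiff_sdiff hB] at hx ⊢
      simp only [Finset.sum_map] at hx
      have := hB'.ker_exchange hexp (x := fun v => x (Sum.inl v)) fun b hb =>
        hx _ (Finset.mem_map_of_mem _ hb)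
      intro v hv
      obtain ⟨y, hy, rfl⟩ := Finset.mem_map.mp hv
      exact this y hy)
  have hHne' : ∀ i j, j ≠ i → H j ≠ H i := fun i j hji hH =>
    hdistinct j i hji (by rw [hH])
  have hcross := sum_le_sum_Qsum (H := H) hq e fun i => by
    have hodd := odd_card_inter_blossom (H := H) (i := i) (Z := symmDiff B B')
      (fun x hx => by
        have hclosed : ∀ {D : Finset (L × Bool)}, (∀ x ∈ D, (x.1, !x.2) ∈ D) →
            ((x.1, !x.2) ∈ D ↔ x ∈ D) :=
          fun hD => ⟨fun h => by simpa using hD _ h, hD x⟩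
        simpa only [Finset.mem_symmDiff, hclosed hparity, hclosed hpar'] using hx)
      (hHline i) (htip i) (hbud i)
      (fun j hj => by
        rw [htipmem i j hj, hbudmem i j hj, Finset.ssubset_iff_subset_ne,
          and_iff_left (hHne' i j hj)])
    rwa [← Finset.card_inter_add_card_sdiff _ Bstar, Finset.inter_right_comm,
      ← Finset.sdiff_inter_right_comm] at hodd
  have hmatch : ∑ u, Qsum H q u.1 (e u).1 ≤
      ∑ v ∈ (Tset L lam ∪ Z) \ Bstar, p v - ∑ u ∈ (Tset L lam ∪ Z) ∩ Bstar, p u := by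
    rw [← Finset.sum_coe_sort _ p, ← Finset.sum_coe_sort _ p, ← e.sum_comp,
      ← Finset.sum_sub_distrib]
    refine Finset.sum_le_sum fun u _ => ?_
    have hu := (Finset.mem_inter.mp u.2).2
    have hv := Finset.mem_compl.mpr (Finset.mem_sdiff.mp (e u).2).2
    refine hDF2 ⟨u, hu⟩ ⟨e u, hv⟩ ?_
    rw [← Matrix.extendZero_apply Cs hu hv]
    exact he u
  have hbudtip : ∑ i : Fin lam, (if bud i ∈ Bstar then p (tip i) - p (bud i)
      else p (bud i) - p (tip i)) = ∑ i, q i := by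
    refine Finset.sum_congr rfl fun i _ => ?_
    split_ifs with hb
    · have ht := Finset.mem_compl.mpr ((hBstarT i).mp hb)
      exact hDF3 i ⟨bud i, hb⟩ ⟨tip i, ht⟩ (hBT2 i hb ht).1 rfl
    · have ht : tip i ∈ Bstar := by
        by_contra ht
        exact hb ((hBstarT i).mpr ht)
      have hb' := Finset.mem_compl.mpr hb
      exact hDF3 i ⟨tip i, ht⟩ ⟨bud i, hb'⟩ (hBT2' i hb' ht).1 (Finset.pair_comm _ _)
  have hp := hsigned p
  rw [hbudtip, sum_eq_sum_lines hparity, sum_eq_sum_lines hpar'] at hp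
  simp only [hDF1] at hp
  linarith
end

section
/- det Φ_A(θ) is nonzero if and only if a parity base exists; moreover, if a parity base exists, then the degree in θ of det Φ_A(θ) equals 2·(Σ_{ℓ∈L} w_ℓ − ζ), where ζ is the minimum of Σ_{ℓ ⊆ B} w_ℓ over all parity bases B. (This is the determinant form of the identity ζ = Σ_{ℓ∈L} w_ℓ − deg_θ Pf Φ_A(θ), using det Φ = (Pf Φ)².) -/
open Matrix Polynomial

/-- A parity base: a base that is a union of lines. -/
def Matrix.IsParityBase {K U L : Type*} [CommRing K] [Fintype U] [Fintype L]
    [DecidableEq U] (A : Matrix U (L × Bool) K) (B : Finset (L × Bool)) : Prop :=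
  A.IsBase B ∧ ∀ x ∈ B, (x.1, !x.2) ∈ B

/-- The weight `Σ_{ℓ ⊆ B} w ℓ` of the set of lines contained in a parity set `B`. -/
def lineWeight {L : Type*} [Fintype L] [DecidableEq L] (w : L → ℕ)
    (B : Finset (L × Bool)) : ℕ :=
  ∑ ℓ ∈ Finset.univ.filter (fun ℓ : L => (ℓ, true) ∈ B ∧ (ℓ, false) ∈ B), w ℓ

/-- The skew-symmetric polynomial matrix
`Φ_A(θ) = [[0, A], [−Aᵀ, D(θ)]]` over `K[τ_ℓ : ℓ ∈ L][θ]`, where `D(θ)` is block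
diagonal with the block `[[0, −τ_ℓ θ^{w ℓ}], [τ_ℓ θ^{w ℓ}, 0]]` in the rows and columns
of the line `ℓ` (ordered `(ℓ, false), (ℓ, true)`), and the `τ_ℓ` are independent
indeterminates. -/
noncomputable def PhiMat {K U L : Type*} [Field K] [Fintype U] [Fintype L]
    [DecidableEq L] (A : Matrix U (L × Bool) K) (w : L → ℕ) :
    Matrix (U ⊕ (L × Bool)) (U ⊕ (L × Bool)) (Polynomial (MvPolynomial L K)) :=
  Matrix.fromBlocks 0 (A.map (fun a => Polynomial.C (MvPolynomial.C a)))
    (-(A.map (fun a => Polynomial.C (MvPolynomial.C a)))ᵀ)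
    (Matrix.of fun x y : L × Bool =>
      if x.1 = y.1 then
        if x.2 = false ∧ y.2 = true then
          -(Polynomial.C (MvPolynomial.X x.1) * Polynomial.X ^ w x.1)
        else if x.2 = true ∧ y.2 = false then
          Polynomial.C (MvPolynomial.X x.1) * Polynomial.X ^ w x.1
        else 0
      else 0)

/-- The determinant of an alternating matrix over a field is a square. -/
theorem Matrix.isSquare_det_of_alternating {F : Type*} [Field F] {n : Type*} [Fintype n]
    [DecidableEq n] (M : Matrix n n F) (hT : Mᵀ = -M) (hd : ∀ i, M i i = 0) :
    IsSquare M.det := by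
  classical
  induction hc : Fintype.card n using Nat.strong_induction_on generalizing n with
  | _ c ih =>
  subst hc
  by_cases h0 : M = 0
  · subst h0
    rcases isEmpty_or_nonempty n with h | h
    · simp
    · simp [Matrix.det_zero]
  obtain ⟨i, j, hij⟩ : ∃ i j, M i j ≠ 0 := by
    by_contra! h
    exact h0 (Matrix.ext h)
  have hne : i ≠ j := by
    rintro rfl
    exact hij (hd i)
  have hskew : ∀ a b, M b a = -M a b := fun a b => congrFun (congrFun hT a) b
  have hf : Function.Injective ![i, j] := by
    intro a b
    fin_cases a <;> fin_cases b <;> simp [hne, hne.symm]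
  let e : Fin 2 ⊕ ↥(Set.range ![i, j])ᶜ ≃ n :=
    (Equiv.sumCongr (Equiv.ofInjective _ hf) (Equiv.refl _)).trans (Equiv.Set.sumCompl _)
  have hcard : Fintype.card ↥(Set.range ![i, j])ᶜ < Fintype.card n := by
    have := Fintype.card_congr e
    rw [Fintype.card_sum, Fintype.card_fin] at this
    omega
  set N := M.submatrix e e with hN
  have hNskew : ∀ a b, N b a = -N a b := fun a b => hskew _ _
  have hNd : ∀ a, N a a = 0 := fun a => hd _
  have hx : N (Sum.inl 0) (Sum.inl 1) ≠ 0 := hij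
  have hdet11 : N.toBlocks₁₁.det = N (Sum.inl 0) (Sum.inl 1) * N (Sum.inl 0) (Sum.inl 1) := by
    rw [Matrix.det_fin_two]
    simp only [Matrix.toBlocks₁₁, Matrix.of_apply, hNd]
    rw [hNskew (Sum.inl 0) (Sum.inl 1)]
    ring
  have hunit : IsUnit N.toBlocks₁₁.det := by
    rw [hdet11]
    exact (mul_ne_zero hx hx).isUnit
  have : Invertible N.toBlocks₁₁ := Matrix.invertibleOfIsUnitDet _ hunit
  rw [← Matrix.det_submatrix_equiv_self e M, ← hN, ← Matrix.fromBlocks_toBlocks N,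
    Matrix.det_fromBlocks₁₁]
  have hQ : ∀ a b, (⅟N.toBlocks₁₁) b a = -(⅟N.toBlocks₁₁) a b ∧ (⅟N.toBlocks₁₁) a a = 0 := by
    have hskew' : N (Sum.inl 1) (Sum.inl 0) = -N (Sum.inl 0) (Sum.inl 1) := hNskew _ _
    intro a b
    rw [Matrix.invOf_eq_nonsing_inv, Matrix.inv_def, Matrix.adjugate_fin_two]
    fin_cases a <;> fin_cases b <;> simp [Matrix.toBlocks₁₁, hNd, hskew']
  generalize ⅟N.toBlocks₁₁ = Q at hQ
  refine IsSquare.mul ⟨_, hdet11⟩ (ih _ hcard _ ?_ ?_ rfl)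
  · ext a b
    simp only [Matrix.transpose_apply, Matrix.neg_apply, Matrix.sub_apply, Matrix.mul_apply,
      Fin.sum_univ_two, Matrix.toBlocks₁₂, Matrix.toBlocks₂₁, Matrix.toBlocks₂₂, Matrix.of_apply,
      (hQ 0 0).2, (hQ 1 1).2, (hQ 0 1).1, hNskew (Sum.inr a) (Sum.inr b),
      hNskew (Sum.inl _) (Sum.inr _)]
    ring
  · intro a
    simp only [Matrix.sub_apply, Matrix.mul_apply,
      Fin.sum_univ_two, Matrix.toBlocks₁₂, Matrix.toBlocks₂₁, Matrix.toBlocks₂₂, Matrix.of_apply,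
      (hQ 0 0).2, (hQ 1 1).2, (hQ 0 1).1, hNd, hNskew (Sum.inl _) (Sum.inr _)]
    ring

/-- The determinant of an alternating matrix over an integrally closed domain is a square. -/
theorem Matrix.isSquare_det_of_alternating_of_isIntegrallyClosed {R : Type*} [CommRing R]
    [IsDomain R] [IsIntegrallyClosed R] {n : Type*} [Fintype n]
    [DecidableEq n] (M : Matrix n n R) (hT : Mᵀ = -M) (hd : ∀ i, M i i = 0) :
    IsSquare M.det := by
  have hsq := Matrix.isSquare_det_of_alternating (M.map (algebraMap R (FractionRing R)))
    (by ext a b; simpa using congrArg (algebraMap R (FractionRing R)) (congrFun (congrFun hT a) b))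
    (by intro i; simp [hd i])
  obtain ⟨c, hc⟩ := hsq
  have hmap : algebraMap R (FractionRing R) M.det = c * c := by
    rw [← hc, RingHom.map_det]
    rfl
  obtain ⟨r, rfl⟩ := IsIntegrallyClosed.exists_algebraMap_eq_of_isIntegral_pow (R := R) (x := c)
    two_pos (by rw [pow_two, ← hmap]; exact isIntegral_algebraMap)
  exact ⟨r, IsFractionRing.injective R (FractionRing R) (by rw [hmap, map_mul])⟩

/-- The block-diagonal alternating matrix whose block at the line `ℓ` is
`[[0, -x ℓ], [x ℓ, 0]]`. -/
def lineForm {L R : Type*} [DecidableEq L] [CommRing R] (x : L → R) :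
    Matrix (L × Bool) (L × Bool) R :=
  Matrix.of fun p q =>
    if p.1 = q.1 then
      if p.2 = false ∧ q.2 = true then -x p.1
      else if p.2 = true ∧ q.2 = false then x p.1
      else 0
    else 0

/-- The alternating matrix `[[0, A], [-Aᵀ, D]]` with line variables `x ℓ` in `D`. -/
def lineBlockMatrix {U L R : Type*} [DecidableEq L] [CommRing R] (A : Matrix U (L × Bool) R)
    (x : L → R) : Matrix (U ⊕ (L × Bool)) (U ⊕ (L × Bool)) R :=
  Matrix.fromBlocks 0 A (-Aᵀ) (lineForm x)

theorem lineBlockMatrix_transpose {U L R : Type*} [DecidableEq L] [CommRing R]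
    (A : Matrix U (L × Bool) R) (x : L → R) :
    (lineBlockMatrix A x)ᵀ = -lineBlockMatrix A x := by
  ext (i | ⟨ℓ, a⟩) (j | ⟨k, b⟩)
  · simp [lineBlockMatrix]
  · simp [lineBlockMatrix]
  · simp [lineBlockMatrix]
  · by_cases h : ℓ = k
    · subst h
      cases a <;> cases b <;> simp [lineBlockMatrix, lineForm]
    · simp [lineBlockMatrix, lineForm, h, Ne.symm h]

theorem lineBlockMatrix_apply_self {U L R : Type*} [DecidableEq L] [CommRing R]
    (A : Matrix U (L × Bool) R) (x : L → R) (i : U ⊕ (L × Bool)) :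
    lineBlockMatrix A x i i = 0 := by
  rcases i with i | ⟨ℓ, a⟩
  · simp [lineBlockMatrix]
  · cases a <;> simp [lineBlockMatrix, lineForm]

/-- The constant matrix that takes from `[[0, A], [-Aᵀ, D]]` the rows of `[[0, 0], [0, D]]` (with
all line variables equal to `1`) at the indices in `S`, and the rows of `[[0, A], [-Aᵀ, 0]]` at the
other indices. -/
def rowSelection {U L R : Type*} [DecidableEq U] [DecidableEq L] [CommRing R]
    (A : Matrix U (L × Bool) R) (S : Finset (U ⊕ (L × Bool))) :
    Matrix (U ⊕ (L × Bool)) (U ⊕ (L × Bool)) R :=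
  Matrix.of fun i j =>
    if i ∈ S then Matrix.fromBlocks 0 0 0 (lineForm fun _ => 1) i j
    else Matrix.fromBlocks 0 A (-Aᵀ) 0 i j

/-- The exponent contributed by a row of `[[0, A], [-Aᵀ, D]]`. -/
noncomputable def rowExponent {U L : Type*} : U ⊕ (L × Bool) → L →₀ ℕ :=
  Sum.elim 0 fun p => Finsupp.single p.1 1

theorem det_lineBlockMatrix_X {K U L : Type*} [CommRing K] [Fintype U] [Fintype L]
    [DecidableEq U] [DecidableEq L] (A : Matrix U (L × Bool) K) :
    (lineBlockMatrix (A.map MvPolynomial.C) (MvPolynomial.X : L → MvPolynomial L K)).det =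
      ∑ S, MvPolynomial.monomial (∑ i ∈ S, rowExponent i) (rowSelection A S).det := by
  have hsplit : lineBlockMatrix (A.map MvPolynomial.C) (MvPolynomial.X : L → MvPolynomial L K) =
      Matrix.of ((fun i j => MvPolynomial.monomial (rowExponent i) (1 : K) * MvPolynomial.C
          (Matrix.fromBlocks (0 : Matrix U U K) 0 0 (lineForm fun _ => (1 : K)) i j)) +
        fun i j => MvPolynomial.C (Matrix.fromBlocks 0 A (-Aᵀ) 0 i j)) := by
    ext1 (i | p) (j | q)
    · simp [lineBlockMatrix]
    · simp [lineBlockMatrix]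
    · simp [lineBlockMatrix]
    · simp only [lineBlockMatrix, lineForm, rowExponent, Matrix.fromBlocks_apply₂₂, Matrix.of_apply,
        Pi.add_apply, Sum.elim_inr, Matrix.zero_apply, map_zero, add_zero]
      split_ifs <;> simp [MvPolynomial.X]
  rw [hsplit]
  refine (Matrix.detRowAlternating.toMultilinearMap.map_add_univ _ _).trans ?_
  refine Finset.sum_congr rfl fun S _ => ?_
  have hrow : Matrix.of (S.piecewise (fun i j => MvPolynomial.monomial (rowExponent i) (1 : K) *
        MvPolynomial.C (Matrix.fromBlocks (0 : Matrix U U K) 0 0 (lineForm fun _ => (1 : K)) i j))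
        fun i j => MvPolynomial.C (Matrix.fromBlocks 0 A (-Aᵀ) 0 i j)) =
      Matrix.of fun i j => (if i ∈ S then MvPolynomial.monomial (rowExponent i) (1 : K) else 1) *
        (rowSelection A S).map MvPolynomial.C i j := by
    ext1 i j
    by_cases h : i ∈ S <;> simp [rowSelection, h]
  refine (congrArg Matrix.det hrow).trans ?_
  rw [Matrix.det_mul_column, Finset.prod_ite_mem, Finset.univ_inter]
  rw [← MvPolynomial.monomial_sum_one, ← RingHom.mapMatrix_apply, ← RingHom.map_det,
    mul_comm, MvPolynomial.C_mul_monomial, mul_one]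

/-- The exponent of the squarefree monomial with support `T`. -/
noncomputable def squarefreeExponent {L : Type*} (T : Finset L) : L →₀ ℕ :=
  ∑ ℓ ∈ T, Finsupp.single ℓ 1

theorem squarefreeExponent_apply {L : Type*} [DecidableEq L] (T : Finset L) (ℓ : L) :
    squarefreeExponent T ℓ = if ℓ ∈ T then 1 else 0 := by
  simp [squarefreeExponent, Finsupp.finsetSum_apply, Finsupp.single_apply]

theorem eq_squarefreeExponent_support {L : Type*} (m : L →₀ ℕ) (hm : ∀ ℓ, m ℓ ≤ 1) :
    m = squarefreeExponent m.support := by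
  classical
  ext ℓ
  have := hm ℓ
  rw [squarefreeExponent_apply]
  split_ifs with h
  · have := Finsupp.mem_support_iff.1 h
    omega
  · exact Finsupp.notMem_support_iff.1 h

theorem MvPolynomial.coeff_two_nsmul_squarefreeExponent_mul_self {L R : Type*} [CommRing R]
    (P : MvPolynomial L R) (hP : ∀ m ∈ P.support, ∀ ℓ, m ℓ ≤ 1) (T : Finset L) :
    (P * P).coeff (2 • squarefreeExponent T) =
      P.coeff (squarefreeExponent T) * P.coeff (squarefreeExponent T) := by
  classical
  rw [MvPolynomial.coeff_mul]
  refine Finset.sum_eq_single (squarefreeExponent T, squarefreeExponent T) ?_ ?_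
  · rintro ⟨x, y⟩ hxy hne
    by_contra h0
    have hx := hP x (MvPolynomial.mem_support_iff.2 (left_ne_zero_of_mul h0))
    have hy := hP y (MvPolynomial.mem_support_iff.2 (right_ne_zero_of_mul h0))
    have hadd := Finset.HasAntidiagonal.mem_antidiagonal.1 hxy
    have key : ∀ ℓ, x ℓ = squarefreeExponent T ℓ ∧ y ℓ = squarefreeExponent T ℓ := by
      intro ℓ
      have h1 := DFunLike.congr_fun hadd ℓ
      have h2 := hx ℓ
      have h3 := hy ℓ
      simp only [Finsupp.add_apply, Finsupp.smul_apply, squarefreeExponent_apply,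
        smul_eq_mul] at h1 ⊢
      split_ifs at h1 ⊢ <;> omega
    exact hne (Prod.ext (Finsupp.ext fun ℓ => (key ℓ).1) (Finsupp.ext fun ℓ => (key ℓ).2))
  · intro h
    exact absurd (Finset.HasAntidiagonal.mem_antidiagonal.2 (two_nsmul _).symm) h

theorem apply_le_two_of_mem_support_det_lineBlockMatrix {K U L : Type*} [CommRing K] [Fintype U]
    [Fintype L] [DecidableEq U] [DecidableEq L] (A : Matrix U (L × Bool) K) (m : L →₀ ℕ)
    (hm : m ∈ (lineBlockMatrix (A.map MvPolynomial.C)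
      (MvPolynomial.X : L → MvPolynomial L K)).det.support) (ℓ : L) : m ℓ ≤ 2 := by
  rw [MvPolynomial.mem_support_iff, det_lineBlockMatrix_X, MvPolynomial.coeff_sum] at hm
  obtain ⟨S, -, hS⟩ := Finset.exists_ne_zero_of_sum_ne_zero hm
  rw [MvPolynomial.coeff_monomial] at hS
  obtain rfl : ∑ i ∈ S, rowExponent i = m := by
    by_contra h
    simp [h] at hS
  rw [Finsupp.finsetSum_apply]
  refine (Finset.sum_le_sum_of_subset (Finset.subset_univ S)).trans ?_
  simp only [rowExponent, Fintype.sum_sum_type, Sum.elim_inl, Sum.elim_inr, Fintype.sum_prod_type,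
    Fintype.sum_bool, Finsupp.single_apply, Pi.zero_apply, Finsupp.coe_zero,
    Finset.sum_const_zero, zero_add, Finset.sum_add_distrib]
  simp

theorem coeff_two_nsmul_squarefreeExponent_det_lineBlockMatrix {K U L : Type*} [CommRing K]
    [Fintype U] [Fintype L] [DecidableEq U] [DecidableEq L] (A : Matrix U (L × Bool) K)
    (T : Finset L) :
    (lineBlockMatrix (A.map MvPolynomial.C)
      (MvPolynomial.X : L → MvPolynomial L K)).det.coeff (2 • squarefreeExponent T) =
      (rowSelection A ((T ×ˢ Finset.univ).map Function.Embedding.inr)).det := by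
  have hexp : ∑ i ∈ (T ×ˢ (Finset.univ : Finset Bool)).map
      (Function.Embedding.inr : _ ↪ U ⊕ (L × Bool)), rowExponent i = 2 • squarefreeExponent T := by
    simp [rowExponent, Finset.sum_product, squarefreeExponent, Finset.smul_sum]
  rw [det_lineBlockMatrix_X, MvPolynomial.coeff_sum,
    Finset.sum_eq_single ((T ×ˢ Finset.univ).map Function.Embedding.inr)]
  · rw [hexp, MvPolynomial.coeff_monomial, if_pos rfl]
  · intro S _ hS
    rw [MvPolynomial.coeff_monomial]
    split_ifs with hSe
    swap
    · rfl
    by_cases hu : ∃ u, Sum.inl u ∈ S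
    · obtain ⟨u, hu⟩ := hu
      refine Matrix.det_eq_zero_of_row_eq_zero (Sum.inl u) fun j => ?_
      cases j <;> simp [rowSelection, hu]
    · push Not at hu
      have hsub : S ⊆ (T ×ˢ Finset.univ).map Function.Embedding.inr := by
        rintro (u | p) hi
        · exact absurd hi (hu u)
        · have h1 : rowExponent (Sum.inr p : U ⊕ (L × Bool)) p.1 ≤ (2 • squarefreeExponent T) p.1 := by
            rw [← hSe, Finsupp.finsetSum_apply]
            exact Finset.single_le_sum (f := fun i => rowExponent i p.1)
              (fun _ _ => Nat.zero_le _) hi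
          simp only [rowExponent, Sum.elim_inr, Finsupp.single_eq_same, Finsupp.smul_apply,
            squarefreeExponent_apply, smul_eq_mul] at h1
          have : p.1 ∈ T := by
            by_contra h
            simp [h] at h1
          simpa using this
      have hsum := Finset.sum_sdiff (f := rowExponent) hsub
      rw [hSe, hexp, add_eq_right] at hsum
      refine absurd (Finset.Subset.antisymm hsub fun i hi => ?_) hS
      by_contra hiS
      have h0 := (Finset.sum_eq_zero_iff.1 hsum) i (Finset.mem_sdiff.2 ⟨hi, hiS⟩)
      obtain ⟨p, -, rfl⟩ := Finset.mem_map.1 hi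
      simp [rowExponent] at h0
  · simp

theorem rowSelection_mulVec_eq_zero_iff {K U L : Type*} [CommRing K] [Fintype U] [Fintype L]
    [DecidableEq U] [DecidableEq L] (A : Matrix U (L × Bool) K) (T : Finset L)
    (z : U ⊕ (L × Bool) → K) :
    rowSelection A ((T ×ˢ Finset.univ).map Function.Embedding.inr) *ᵥ z = 0 ↔
      (A *ᵥ (z ∘ Sum.inr) = 0) ∧ (∀ p : L × Bool, p.1 ∈ T → z (Sum.inr p) = 0) ∧
        ∀ p : L × Bool, p.1 ∉ T → ((z ∘ Sum.inl) ᵥ* A) p = 0 := by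
  have hinl : ∀ u, (rowSelection A ((T ×ˢ Finset.univ).map Function.Embedding.inr) *ᵥ z)
      (Sum.inl u) = (A *ᵥ (z ∘ Sum.inr)) u := by
    intro u
    simp [rowSelection, Matrix.mulVec, dotProduct]
  have hmem : ∀ p : L × Bool, p.1 ∈ T →
      (rowSelection A ((T ×ˢ Finset.univ).map Function.Embedding.inr) *ᵥ z) (Sum.inr p) =
        if p.2 then z (Sum.inr (p.1, false)) else -z (Sum.inr (p.1, true)) := by
    rintro ⟨ℓ, b⟩ hp
    simp only at hp
    cases b <;> simp [rowSelection, Matrix.mulVec, dotProduct, lineForm, hp,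
      Fintype.sum_prod_type, ite_and]
  have hnot : ∀ p : L × Bool, p.1 ∉ T →
      (rowSelection A ((T ×ˢ Finset.univ).map Function.Embedding.inr) *ᵥ z) (Sum.inr p) =
        -((z ∘ Sum.inl) ᵥ* A) p := by
    intro p hp
    have hS : (Sum.inr p : U ⊕ (L × Bool)) ∉
        (T ×ˢ (Finset.univ : Finset Bool)).map Function.Embedding.inr := by
      rintro h
      obtain ⟨q, hq, h⟩ := Finset.mem_map.1 h
      cases h
      exact hp (Finset.mem_product.1 hq).1
    simp only [rowSelection, Matrix.mulVec, dotProduct, Matrix.of_apply, if_neg hS]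
    simp [Matrix.vecMul, dotProduct, mul_comm]
  constructor
  · intro h
    refine ⟨funext fun u => by rw [← hinl, h]; rfl, ?_, fun p hp => ?_⟩
    · rintro ⟨ℓ, b⟩ hp
      cases b
      · have := hmem (ℓ, true) hp
        rw [h] at this
        simpa using this.symm
      · have := hmem (ℓ, false) hp
        rw [h] at this
        simpa using this.symm
    · have := hnot p hp
      rw [h] at this
      simpa using this.symm
  · rintro ⟨h1, h2, h3⟩
    ext (u | p)
    · rw [hinl, h1]
      rfl
    · by_cases hp : p.1 ∈ T
      · rw [hmem p hp, h2 (p.1, false) hp, h2 (p.1, true) hp]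
        simp
      · rw [hnot p hp, h3 p hp]
        simp

theorem Matrix.isBase_iff_forall {K U V : Type*} [Field K] [Fintype U] [Fintype V] [DecidableEq U]
    (A : Matrix U V K) (B : Finset V) :
    A.IsBase B ↔ (∀ v : V → K, (∀ p ∉ B, v p = 0) → A *ᵥ v = 0 → v = 0) ∧
      ∀ u : U → K, (∀ p ∈ B, (u ᵥ* A) p = 0) → u = 0 := by
  classical
  have hsum : ∀ v : V → K, (∀ p ∉ B, v p = 0) → ∀ i,
      (A *ᵥ v) i = ∑ b : B, A i b * v b := by
    intro v hv i
    rw [Finset.sum_coe_sort B fun b => A i b * v b]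
    exact (Finset.sum_subset (Finset.subset_univ B) fun p _ hp => by rw [hv p hp, mul_zero]).symm
  constructor
  · rintro ⟨e, he⟩
    refine ⟨fun v hv hAv => ?_, fun u hu => ?_⟩
    · have h0 : (fun i => v (e i)) = 0 := by
        by_contra h
        refine he (Matrix.exists_mulVec_eq_zero_iff.1 ⟨_, h, funext fun i => ?_⟩)
        have h1 := hsum v hv i
        rw [hAv, ← e.sum_comp] at h1
        exact h1.symm
      funext p
      by_cases hp : p ∈ B
      · simpa using congrFun h0 (e.symm ⟨p, hp⟩)
      · exact hv p hp
    · by_contra h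
      exact he (Matrix.exists_vecMul_eq_zero_iff.1 ⟨u, h, funext fun i => hu _ (e i).2⟩)
  · rintro ⟨h1, h2⟩
    have inj1 : Function.Injective (A.submatrix id (fun b : B => (b : V))).mulVecLin := by
      rw [← LinearMap.ker_eq_bot, LinearMap.ker_eq_bot']
      intro x hx
      have hv : ∀ p ∉ B, (fun p => if h : p ∈ B then x ⟨p, h⟩ else 0) p = 0 := by
        intro p hp
        simp [hp]
      have := h1 _ hv (funext fun i => by
        rw [hsum _ hv i]
        simpa [Matrix.mulVec, dotProduct] using congrFun hx i)
      funext b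
      simpa using congrFun this b
    have inj2 : Function.Injective (A.submatrix id (fun b : B => (b : V))).vecMulLinear := by
      rw [← LinearMap.ker_eq_bot, LinearMap.ker_eq_bot']
      intro u hu
      exact h2 u fun p hp => congrFun hu ⟨p, hp⟩
    have e : U ≃ B := Fintype.equivOfCardEq
      (le_antisymm (card_le_of_injective K _ inj2) (card_le_of_injective K _ inj1))
    refine ⟨e, fun h => ?_⟩
    obtain ⟨u, hu0, hu⟩ := Matrix.exists_vecMul_eq_zero_iff.2 h
    refine hu0 (h2 u fun p hp => ?_)
    simpa [Matrix.vecMul, dotProduct] using congrFun hu (e.symm ⟨p, hp⟩)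

theorem det_rowSelection_ne_zero_iff {K U L : Type*} [Field K] [Fintype U] [Fintype L]
    [DecidableEq U] [DecidableEq L] (A : Matrix U (L × Bool) K) (T : Finset L) :
    (rowSelection A ((T ×ˢ Finset.univ).map Function.Embedding.inr)).det ≠ 0 ↔
      A.IsParityBase (Tᶜ ×ˢ Finset.univ) := by
  have hpar : A.IsParityBase (Tᶜ ×ˢ Finset.univ) ↔ A.IsBase (Tᶜ ×ˢ Finset.univ) :=
    ⟨fun h => h.1, fun h => ⟨h, by simp⟩⟩
  rw [hpar, Matrix.isBase_iff_forall, Ne, ← Matrix.exists_mulVec_eq_zero_iff]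
  simp only [rowSelection_mulVec_eq_zero_iff]
  constructor
  · intro h
    push Not at h
    refine ⟨fun v hv hAv => ?_, fun u hu => ?_⟩
    · by_contra hv0
      obtain ⟨p, hp, hp'⟩ := h (Sum.elim 0 v)
        (fun h0 => hv0 (funext fun p => congrFun h0 (Sum.inr p)))
        (by simpa using hAv) (fun p hp => hv p (by simp [hp]))
      simp at hp'
    · by_contra hu0
      obtain ⟨p, hp, hp'⟩ := h (Sum.elim u 0)
        (fun h0 => hu0 (funext fun p => congrFun h0 (Sum.inl p)))
        (by simp) (fun p hp => rfl)
      exact hp' (hu p (by simp [hp]))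
  · rintro ⟨h1, h2⟩ ⟨z, hz, hA, hT, hB⟩
    refine hz ?_
    have hv := h1 (z ∘ Sum.inr) (fun p hp => hT p (by simpa using hp)) hA
    have hu := h2 (z ∘ Sum.inl) (fun p hp => hB p (by simpa using hp))
    ext (i | p)
    · exact congrFun hu i
    · exact congrFun hv p

theorem lineWeight_product_univ {L : Type*} [Fintype L] [DecidableEq L] (w : L → ℕ)
    (S : Finset L) : lineWeight w (S ×ˢ Finset.univ) = ∑ ℓ ∈ S, w ℓ := by
  simp [lineWeight]

theorem Matrix.IsParityBase.exists_eq_product {K U L : Type*} [CommRing K] [Fintype U] [Fintype L]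
    [DecidableEq U] [DecidableEq L] {A : Matrix U (L × Bool) K} {B : Finset (L × Bool)}
    (hB : A.IsParityBase B) : ∃ T : Finset L, B = Tᶜ ×ˢ Finset.univ := by
  refine ⟨Finset.univ.filter fun ℓ => (ℓ, true) ∉ B, ?_⟩
  ext ⟨ℓ, b⟩
  cases b
  · have h1 := hB.2 (ℓ, true)
    have h2 := hB.2 (ℓ, false)
    simp only [Bool.not_true, Bool.not_false] at h1 h2
    simpa using ⟨h2, h1⟩
  · simp

/-- The substitution `X ℓ ↦ τ_ℓ θ ^ w ℓ`. -/
noncomputable def weightSubst {K L : Type*} [CommRing K] (w : L → ℕ) :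
    MvPolynomial L K →+* Polynomial (MvPolynomial L K) :=
  MvPolynomial.eval₂Hom (Polynomial.C.comp MvPolynomial.C)
    fun ℓ => Polynomial.C (MvPolynomial.X ℓ) * Polynomial.X ^ w ℓ

theorem weightSubst_eq_sum {K L : Type*} [CommRing K] [Fintype L] (w : L → ℕ)
    (P : MvPolynomial L K) :
    weightSubst w P = ∑ m ∈ P.support,
      Polynomial.C (MvPolynomial.monomial m (P.coeff m)) * Polynomial.X ^ (∑ ℓ, m ℓ * w ℓ) := by
  rw [weightSubst, MvPolynomial.coe_eval₂Hom, MvPolynomial.eval₂_eq']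
  refine Finset.sum_congr rfl fun m _ => ?_
  rw [MvPolynomial.monomial_eq, Finsupp.prod_fintype _ _ (by simp)]
  simp only [mul_pow, Finset.prod_mul_distrib, ← pow_mul, Finset.prod_pow_eq_pow_sum, map_mul,
    map_prod, map_pow, RingHom.comp_apply, mul_assoc, mul_comm (w _)]

theorem degree_weightSubst {K L : Type*} [CommRing K] [Fintype L] (w : L → ℕ)
    (P : MvPolynomial L K) {m₀ : L →₀ ℕ} (hm₀ : m₀ ∈ P.support)
    (hmax : ∀ m ∈ P.support, ∑ ℓ, m ℓ * w ℓ ≤ ∑ ℓ, m₀ ℓ * w ℓ) :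
    (weightSubst w P).degree = ((∑ ℓ, m₀ ℓ * w ℓ : ℕ) : WithBot ℕ) := by
  classical
  rw [weightSubst_eq_sum]
  refine Polynomial.degree_eq_of_le_of_coeff_ne_zero ?_ fun h => ?_
  · refine (Polynomial.degree_sum_le _ _).trans (Finset.sup_le fun m hm => ?_)
    exact (Polynomial.degree_C_mul_X_pow_le _ _).trans (by exact_mod_cast hmax m hm)
  · have h1 := congrArg (MvPolynomial.coeff m₀) h
    simp only [Polynomial.finsetSum_coeff, Polynomial.coeff_C_mul_X_pow, MvPolynomial.coeff_sum,
      MvPolynomial.coeff_zero] at h1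
    rw [Finset.sum_eq_single_of_mem m₀ hm₀] at h1
    · simp only [if_true, MvPolynomial.coeff_monomial] at h1
      exact MvPolynomial.mem_support_iff.1 hm₀ h1
    · intro m _ hne
      split_ifs
      · rw [MvPolynomial.coeff_monomial, if_neg hne]
      · rfl

theorem PhiMat_det_eq_weightSubst {K U L : Type*} [Field K] [Fintype U] [Fintype L]
    [DecidableEq U] [DecidableEq L] (A : Matrix U (L × Bool) K) (w : L → ℕ) :
    (PhiMat A w).det = weightSubst w (lineBlockMatrix (A.map MvPolynomial.C)
      (MvPolynomial.X : L → MvPolynomial L K)).det := by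
  rw [RingHom.map_det]
  congr 1
  ext1 (i | p) (j | q)
  · simp [PhiMat, lineBlockMatrix]
  · simp [PhiMat, lineBlockMatrix, weightSubst]
  · simp [PhiMat, lineBlockMatrix, weightSubst]
  · simp only [PhiMat, lineBlockMatrix, lineForm, weightSubst, RingHom.mapMatrix_apply,
      Matrix.map_apply, Matrix.fromBlocks_apply₂₂, Matrix.of_apply]
    split_ifs <;> simp

/-- A polynomial playing the role of the Pfaffian of `[[0, A], [-Aᵀ, D]]`: its square is the
determinant, it is multilinear, and its monomials correspond to the parity bases of `A`. -/
theorem exists_pfaffian_lineBlockMatrix {K U L : Type*} [Field K] [Fintype U] [Fintype L]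
    [DecidableEq U] [DecidableEq L] (A : Matrix U (L × Bool) K) :
    ∃ P : MvPolynomial L K,
      (lineBlockMatrix (A.map MvPolynomial.C)
        (MvPolynomial.X : L → MvPolynomial L K)).det = P * P ∧
      (∀ m ∈ P.support, ∀ ℓ, m ℓ ≤ 1) ∧
      ∀ T : Finset L, squarefreeExponent T ∈ P.support ↔
        A.IsParityBase (Tᶜ ×ˢ Finset.univ) := by
  obtain ⟨P, hP⟩ := Matrix.isSquare_det_of_alternating_of_isIntegrallyClosed
    (lineBlockMatrix (A.map MvPolynomial.C) (MvPolynomial.X : L → MvPolynomial L K))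
    (lineBlockMatrix_transpose _ _) (lineBlockMatrix_apply_self _ _)
  have hle : ∀ m ∈ P.support, ∀ ℓ, m ℓ ≤ 1 := by
    intro m hm ℓ
    have hP0 : P ≠ 0 := by
      rintro rfl
      simp at hm
    have hdeg : MvPolynomial.degreeOf ℓ (P * P) ≤ 2 := by
      rw [← hP, MvPolynomial.degreeOf_le_iff]
      exact fun m hm => apply_le_two_of_mem_support_det_lineBlockMatrix A m hm ℓ
    rw [MvPolynomial.degreeOf_mul_eq hP0 hP0] at hdeg
    have := MvPolynomial.monomial_le_degreeOf ℓ hm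
    omega
  refine ⟨P, hP, hle, fun T => ?_⟩
  rw [← det_rowSelection_ne_zero_iff, ← coeff_two_nsmul_squarefreeExponent_det_lineBlockMatrix, hP,
    MvPolynomial.coeff_two_nsmul_squarefreeExponent_mul_self P hle, MvPolynomial.mem_support_iff,
    Ne, Ne, mul_self_eq_zero]

/-- **Determinant form of the Pfaffian formula for the minimum-weight parity base
(Lemma 2.1).**  Let `A` be a full-row-rank matrix over a field `K` with `|U|` even,
whose column set `V = L × Bool` is partitioned into lines with weights `w : L → ℕ`.
Then `det Φ_A(θ) ≠ 0` if and only if a parity base exists; moreover, if `B₀` is a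
parity base of minimum weight `ζ = lineWeight w B₀`, then
`deg_θ det Φ_A(θ) = 2 · (Σ_{ℓ ∈ L} w ℓ − ζ)`. -/
theorem det_Phi_ne_zero_iff_and_degree {K U L : Type*} [Field K] [Fintype U] [Fintype L]
    [DecidableEq U] [DecidableEq L]
    (A : Matrix U (L × Bool) K) (hrank : A.rank = Fintype.card U)
    (hU : Even (Fintype.card U)) (w : L → ℕ) :
    ((PhiMat A w).det ≠ 0 ↔ ∃ B : Finset (L × Bool), A.IsParityBase B) ∧
    (∀ B₀ : Finset (L × Bool), A.IsParityBase B₀ →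
      (∀ B' : Finset (L × Bool), A.IsParityBase B' → lineWeight w B₀ ≤ lineWeight w B') →
      (PhiMat A w).det.degree =
        ((2 * (∑ ℓ, w ℓ - lineWeight w B₀) : ℕ) : WithBot ℕ)) := by
  obtain ⟨P, hP, hle, hbase⟩ := exists_pfaffian_lineBlockMatrix A
  rw [PhiMat_det_eq_weightSubst, hP, map_mul]
  refine ⟨⟨fun h => ?_, ?_⟩, fun B₀ hB₀ hmin => ?_⟩
  · have hP0 : P ≠ 0 := by
      rintro rfl
      simp at h
    obtain ⟨m, hm⟩ := MvPolynomial.support_nonempty.2 hP0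
    rw [eq_squarefreeExponent_support m (hle m hm)] at hm
    exact ⟨_, (hbase _).1 hm⟩
  · rintro ⟨B, hB⟩
    obtain ⟨T, rfl⟩ := hB.exists_eq_product
    obtain ⟨m₀, hm₀, hmax⟩ := Finset.exists_max_image P.support (fun m => ∑ ℓ, m ℓ * w ℓ)
      ⟨_, (hbase T).2 hB⟩
    refine mul_self_ne_zero.2 fun h => ?_
    have := degree_weightSubst w P hm₀ hmax
    exact WithBot.bot_ne_coe (by rwa [h, Polynomial.degree_zero] at this)
  · have hweight : ∀ T : Finset L, ∑ ℓ, squarefreeExponent T ℓ * w ℓ = ∑ ℓ ∈ T, w ℓ := by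
      intro T
      simp [squarefreeExponent_apply]
    obtain ⟨T, rfl⟩ := hB₀.exists_eq_product
    have hcompl : ∀ S : Finset L, ∑ ℓ ∈ S, w ℓ + ∑ ℓ ∈ Sᶜ, w ℓ = ∑ ℓ, w ℓ := fun S =>
      Finset.sum_add_sum_compl S w
    have hdeg := degree_weightSubst w P ((hbase T).2 hB₀) (by
      intro m hm
      obtain ⟨S, rfl⟩ : ∃ S, m = squarefreeExponent S :=
        ⟨_, eq_squarefreeExponent_support m (hle m hm)⟩
      have := hmin _ ((hbase _).1 hm)
      rw [lineWeight_product_univ, lineWeight_product_univ] at this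
      rw [hweight, hweight]
      have h1 := hcompl T
      have h2 := hcompl S
      omega)
    rw [Polynomial.degree_mul, hdeg, hweight, lineWeight_product_univ, ← hcompl T,
      Nat.add_sub_cancel, two_mul, Nat.cast_add]
end

section
/- Suppose that (p, q) satisfies (DF2). Let X ⊆ V* be a vertex subset such that C*[X] is nonsingular. Then Σ_{v ∈ X∖B*} p(v) − Σ_{u ∈ X∩B*} p(u) ≥ Σ { q(H) : H ∈ Λ and |X ∩ H| is odd }. -/
open Matrix

theorem Matrix.Nonsing.exists_equiv_forall_ne_zero {K : Type*} [CommRing K] {α β : Type*}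
    [Fintype α] [Fintype β] [DecidableEq α] {M : Matrix α β K} (hM : M.Nonsing) :
    ∃ f : α ≃ β, ∀ a, M a (f a) ≠ 0 := by
  obtain ⟨e, he⟩ := hM
  rw [Matrix.det_apply] at he
  obtain ⟨σ, -, hσ⟩ := Finset.exists_ne_zero_of_sum_ne_zero he
  refine ⟨σ.symm.trans e, fun a ha => hσ ?_⟩
  rw [Finset.prod_eq_zero (Finset.mem_univ (σ.symm a)) (by simpa using ha), smul_zero]

theorem sum_sdiff_eq_sum_equiv {W A : Type*} [DecidableEq W] [AddCommMonoid A]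
    {X B : Finset W} (f : ↥(X ∩ B) ≃ ↥(X \ B)) (g : W → A) :
    ∑ v ∈ X \ B, g v = ∑ u : ↥(X ∩ B), g (f u) := by
  rw [Equiv.sum_comp f (fun v : ↥(X \ B) => g v), Finset.sum_coe_sort (X \ B) g]

theorem exists_crosses_of_odd_card_inter {W : Type*} [DecidableEq W]
    {X B : Finset W} (f : ↥(X ∩ B) ≃ ↥(X \ B)) {S : Finset W} (hS : Odd (X ∩ S).card) :
    ∃ u : ↥(X ∩ B), crosses S u (f u) := by
  by_contra! h
  have hcard : (X ∩ S).card = ∑ x ∈ X, if x ∈ S then 1 else 0 := by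
    rw [← Finset.filter_mem_eq_inter, Finset.card_filter]
  rw [← Finset.sum_inter_add_sum_sdiff X B, sum_sdiff_eq_sum_equiv f,
    ← Finset.sum_coe_sort (X ∩ B)] at hcard
  have hiff (u : ↥(X ∩ B)) : (f u : W) ∈ S ↔ (u : W) ∈ S := by
    have := h u
    unfold crosses at this
    tauto
  simp only [hiff] at hcard
  exact Nat.not_odd_iff_even.mpr ⟨_, hcard⟩ hS

/-- **Feasibility inequality for nonsingular submatrices (Lemma 5.1).**
Suppose `(p, q)` satisfies (DF2), with `q ≥ 0`.  Let `X ⊆ V*` be a vertex subset such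
that `C*[X]` is nonsingular.  Then
`Σ_{v ∈ X∖B*} p v − Σ_{u ∈ X∩B*} p u ≥ Σ { q H : H ∈ Λ, |X ∩ H| odd }`. -/
theorem qsum_odd_le_p_diff {K W I : Type*} [Field K] [Fintype W] [DecidableEq W]
    [Fintype I]
    (Bs : Finset W) (Cs : Matrix ↥Bs ↥(Bsᶜ) K)
    (H : I → Finset W) (q : I → ℝ) (hq : ∀ i, 0 ≤ q i) (p : W → ℝ)
    (hDF2 : DF2 Bs Cs H q p)
    (X : Finset W) (hX : Matrix.Nonsing (csub Bs Cs X)) :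
    ∑ i ∈ Finset.univ.filter (fun i => Odd ((X ∩ H i).card)), q i ≤
      ∑ v ∈ X \ Bs, p v - ∑ u ∈ X ∩ Bs, p u := by
  obtain ⟨f, hf⟩ := hX.exists_equiv_forall_ne_zero
  rw [sum_sdiff_eq_sum_equiv f, ← Finset.sum_coe_sort (X ∩ Bs), ← Finset.sum_sub_distrib]
  calc ∑ i ∈ Finset.univ.filter (fun i => Odd ((X ∩ H i).card)), q i
      ≤ ∑ i, ∑ u : ↥(X ∩ Bs), if crosses (H i) u (f u) then q i else 0 := by
        rw [Finset.sum_filter]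
        refine Finset.sum_le_sum fun i _ => ?_
        have hnonneg (u : ↥(X ∩ Bs)) : 0 ≤ if crosses (H i) u (f u) then q i else 0 := by
          split_ifs
          exacts [hq i, le_rfl]
        split_ifs with hodd
        · obtain ⟨u, hu⟩ := exists_crosses_of_odd_card_inter f hodd
          simpa only [if_pos hu] using
            Finset.single_le_sum (fun u _ => hnonneg u) (Finset.mem_univ u)
        · exact Finset.sum_nonneg fun u _ => hnonneg u
    _ = ∑ u : ↥(X ∩ Bs), Qsum H q u (f u) := by
        rw [Finset.sum_comm]
        simp only [Qsum, Finset.sum_filter]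
    _ ≤ ∑ u : ↥(X ∩ Bs), (p (f u) - p u) :=
        Finset.sum_le_sum fun u _ => hDF2 _ _ (hf u)
end

section
/- Suppose that (p, q) satisfies (DF2). For a vertex set X ⊆ V*, if X admits a tight perfect matching, then every perfect matching of X is tight. -/
open Matrix

/-- `M` is a perfect matching of the vertex set `X`: a bijection between `X ∩ B*` and
`X ∖ B*` such that `C*_{u, M u} ≠ 0` for every `u`. -/
def IsPM {K W : Type*} [Field K] [Fintype W] [DecidableEq W] (Bs : Finset W)
    (Cs : Matrix ↥Bs ↥(Bsᶜ) K) (X : Finset W)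
    (M : ↥(X ∩ Bs) ≃ ↥(X \ Bs)) : Prop :=
  ∀ u, csub Bs Cs X u (M u) ≠ 0

/-- `M` is a *tight* perfect matching of `X`: a perfect matching all of whose edges
`(u, M u)` are tight (`p (M u) − p u = Q_{u, M u}`) and which is consistent with every
blossom `H i` with `q i > 0` (at most one matching edge crosses `H i`). -/
def IsTightPM {K W I : Type*} [Field K] [Fintype W] [DecidableEq W] [Fintype I]
    (Bs : Finset W) (Cs : Matrix ↥Bs ↥(Bsᶜ) K) (H : I → Finset W) (q : I → ℝ)
    (p : W → ℝ) (X : Finset W) (M : ↥(X ∩ Bs) ≃ ↥(X \ Bs)) : Prop :=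
  IsPM Bs Cs X M ∧
  (∀ u, p ((M u : ↥(X \ Bs)) : W) - p ((u : ↥(X ∩ Bs)) : W) =
      Qsum H q ((u : ↥(X ∩ Bs)) : W) ((M u : ↥(X \ Bs)) : W)) ∧
  (∀ i, 0 < q i →
    (Finset.univ.filter (fun u : ↥(X ∩ Bs) =>
        crosses (H i) ((u : ↥(X ∩ Bs)) : W) ((M u : ↥(X \ Bs)) : W))).card ≤ 1)

/-- The number of matching pairs crossing a set has a parity that does not depend on the
matching. -/
theorem card_crosses_cast {W : Type*} [DecidableEq W] {P R : Finset W} (S : Finset W)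
    (M : ↥P ≃ ↥R) :
    ((Finset.univ.filter fun u : ↥P => crosses S (u : W) (M u : W)).card : ZMod 2) =
      (∑ u : ↥P, if (u : W) ∈ S then 1 else 0) + ∑ v : ↥R, if (v : W) ∈ S then 1 else 0 := by
  rw [← Equiv.sum_comp M, ← Finset.sum_add_distrib, Finset.card_filter, Nat.cast_sum]
  refine Finset.sum_congr rfl fun u _ => ?_
  by_cases hu : (u : W) ∈ S <;> by_cases hv : (M u : W) ∈ S <;> simp [crosses, hu, hv]
  decide

/-- A matching with at most one pair crossing `S` minimizes the number of crossing pairs. -/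
theorem card_crosses_le_of_le_one {W : Type*} [DecidableEq W] {P R : Finset W} (S : Finset W)
    (M N : ↥P ≃ ↥R)
    (hN : (Finset.univ.filter fun u : ↥P => crosses S (u : W) (N u : W)).card ≤ 1) :
    (Finset.univ.filter fun u : ↥P => crosses S (u : W) (N u : W)).card ≤
      (Finset.univ.filter fun u : ↥P => crosses S (u : W) (M u : W)).card := by
  have h := (card_crosses_cast S N).trans (card_crosses_cast S M).symm
  rw [ZMod.natCast_eq_natCast_iff'] at h
  omega

/-- Summing `Q` along a matching counts each set with its number of crossing pairs. -/
theorem sum_Qsum {W I : Type*} [DecidableEq W] [Fintype I] {P R : Finset W}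
    (H : I → Finset W) (q : I → ℝ) (M : ↥P ≃ ↥R) :
    ∑ u : ↥P, Qsum H q (u : W) (M u : W) =
      ∑ i, (Finset.univ.filter fun u : ↥P => crosses (H i) (u : W) (M u : W)).card * q i := by
  simp only [Qsum, Finset.sum_filter]
  rw [Finset.sum_comm]
  refine Finset.sum_congr rfl fun i _ => ?_
  rw [← Finset.sum_filter, Finset.sum_const, nsmul_eq_mul]

/-- The total potential difference along a matching does not depend on the matching. -/
theorem sum_potential_sub {W : Type*} {P R : Finset W} (p : W → ℝ) (M : ↥P ≃ ↥R) :
    ∑ u : ↥P, (p (M u : W) - p (u : W)) = ∑ v : ↥R, p (v : W) - ∑ u : ↥P, p (u : W) := by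
  rw [Finset.sum_sub_distrib, Equiv.sum_comp M fun v : ↥R => p (v : W)]

/-- **All perfect matchings of a tightly matchable set are tight (Lemma 5.2).**
Suppose `(p, q)` satisfies (DF2), with `q ≥ 0`.  For a vertex set `X ⊆ V*`, if `X`
admits a tight perfect matching, then every perfect matching of `X` is tight. -/
theorem isTightPM_of_isPM {K W I : Type*} [Field K] [Fintype W] [DecidableEq W]
    [Fintype I]
    (Bs : Finset W) (Cs : Matrix ↥Bs ↥(Bsᶜ) K)
    (H : I → Finset W) (q : I → ℝ) (hq : ∀ i, 0 ≤ q i) (p : W → ℝ)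
    (hDF2 : DF2 Bs Cs H q p)
    (X : Finset W) (hex : ∃ M : ↥(X ∩ Bs) ≃ ↥(X \ Bs), IsTightPM Bs Cs H q p X M) :
    ∀ M : ↥(X ∩ Bs) ≃ ↥(X \ Bs), IsPM Bs Cs X M → IsTightPM Bs Cs H q p X M := by
  intro M hM
  obtain ⟨N, -, hNtight, hNcons⟩ := hex
  have hle : ∀ i ∈ Finset.univ,
      ((Finset.univ.filter fun u : ↥(X ∩ Bs) => crosses (H i) (u : W) (N u : W)).card : ℝ) * q i ≤
      (Finset.univ.filter fun u : ↥(X ∩ Bs) => crosses (H i) (u : W) (M u : W)).card * q i := by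
    intro i _
    rcases (hq i).eq_or_lt with h | h
    · simp [← h]
    · exact mul_le_mul_of_nonneg_right
        (Nat.cast_le.2 (card_crosses_le_of_le_one (H i) M N (hNcons i h))) (hq i)
  have hfeas : ∀ u ∈ Finset.univ,
      Qsum H q ((u : ↥(X ∩ Bs)) : W) (M u : W) ≤ p (M u : W) - p (u : W) :=
    fun u _ => hDF2 _ _ (hM u)
  have htotal : ∑ u : ↥(X ∩ Bs), (p (M u : W) - p (u : W)) =
      ∑ u : ↥(X ∩ Bs), Qsum H q (u : W) (N u : W) := by
    rw [sum_potential_sub, ← sum_potential_sub p N]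
    exact Finset.sum_congr rfl fun u _ => hNtight u
  have hQ_le := Finset.sum_le_sum hle
  rw [← sum_Qsum, ← sum_Qsum] at hQ_le
  have hp_le := Finset.sum_le_sum hfeas
  have hp_eq := le_antisymm hp_le (htotal.trans_le hQ_le)
  have hQ_eq := le_antisymm hQ_le (hp_le.trans_eq htotal)
  refine ⟨hM, fun u => ((Finset.sum_eq_sum_iff_of_le hfeas).1 hp_eq u (Finset.mem_univ u)).symm,
    fun i hi => ?_⟩
  rw [sum_Qsum, sum_Qsum] at hQ_eq
  have hcard := mul_right_cancel₀ hi.ne'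
    ((Finset.sum_eq_sum_iff_of_le hle).1 hQ_eq i (Finset.mem_univ i))
  exact (Nat.cast_injective hcard) ▸ hNcons i hi
end

section
/- Suppose that (p, q) satisfies (DF2). Let b ∈ B* and t ∈ V*∖B* satisfy C*_{bt} ≠ 0, p(b) = p(t), and q(H) = 0 for every H ∈ Λ crossed by (b, t). Let C' be the matrix obtained from C* by pivoting around {b, t}, and restrict it to the rows B*∖{b} and the columns (V*∖B*)∖{t}. Then (DF2) holds for the restricted matrix: for all u ∈ B*∖{b} and v ∈ (V*∖B*)∖{t} with C'_{uv} ≠ 0, one has p(v) − p(u) ≥ Q_{uv}. (This is the dual-feasibility preservation underlying the procedure Expand(H_i) when q(H_i) = 0.) -/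
open Matrix

/-- If `b` and `t` are on the same side of every set of positive weight, then `Q` satisfies
the triangle-type inequality along the path `u, t, b, v`. -/
theorem Qsum_le_add_of_not_crosses {W I : Type*} [DecidableEq W] [Fintype I]
    (H : I → Finset W) (q : I → ℝ) (hq : ∀ i, 0 ≤ q i) {b t : W}
    (hq0 : ∀ i, crosses (H i) b t → q i = 0) (u v : W) :
    Qsum H q u v ≤ Qsum H q u t + Qsum H q b v := by
  simp only [Qsum, Finset.sum_filter, ← Finset.sum_add_distrib]
  refine Finset.sum_le_sum fun i _ => ?_
  have h0 := hq i
  by_cases hbt : crosses (H i) b t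
  · simp [hq0 i hbt]
  · have h : crosses (H i) u v → crosses (H i) u t ∨ crosses (H i) b v := by
      simp only [crosses] at hbt ⊢
      tauto
    split_ifs <;> first | linarith | tauto

/-- A sum over the singleton `{b, t} \ B` has one term. -/
theorem sum_pair_sdiff {M W : Type*} [AddCommMonoid M] [DecidableEq W] {Bs : Finset W}
    {b t : W} (hb : b ∈ Bs) (ht : t ∈ ({b, t} : Finset W) \ Bs)
    (f : ↥(({b, t} : Finset W) \ Bs) → M) : ∑ x, f x = f ⟨t, ht⟩ := by
  refine Fintype.sum_eq_single _ fun x hx => absurd (Subtype.ext ?_) hx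
  have hx' := x.2
  simp only [Finset.mem_sdiff, Finset.mem_insert, Finset.mem_singleton] at hx'
  rcases hx'.1 with h | h
  · exact absurd (h.symm ▸ hb) hx'.2
  · exact h

/-- **Dual feasibility is preserved by expanding a blossom with zero dual value
(`Expand`).**  Suppose `(p, q)` satisfies (DF2), with `q ≥ 0`.  Let `b ∈ B*` and
`t ∈ V* ∖ B*` satisfy `C*_{bt} ≠ 0`, `p b = p t`, and `q H = 0` for every blossom `H`
crossed by `(b, t)`.  Let `C'` be the matrix obtained from `C*` by pivoting around
`{b, t}`, restricted to rows `B* ∖ {b}` and columns `(V* ∖ B*) ∖ {t}`.  Then (DF2)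
holds for the restricted matrix. -/
theorem dualFeasible_after_expand {K W I : Type*} [Field K] [Fintype W] [DecidableEq W]
    [Fintype I]
    (Bs : Finset W) (Cs : Matrix ↥Bs ↥(Bsᶜ) K)
    (H : I → Finset W) (q : I → ℝ) (hq : ∀ i, 0 ≤ q i) (p : W → ℝ)
    (hDF2 : DF2 Bs Cs H q p)
    (b t : W) (hb : b ∈ Bs) (ht : t ∈ Bsᶜ)
    (hbt : Cs ⟨b, hb⟩ ⟨t, ht⟩ ≠ 0) (hp : p b = p t)
    (hq0 : ∀ i, crosses (H i) b t → q i = 0)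
    (C' : Matrix ↥(symmDiff Bs ({b, t} : Finset W))
      ↥((symmDiff Bs ({b, t} : Finset W))ᶜ) K)
    (hC' : IsPivot Bs ({b, t} : Finset W) Cs C') :
    ∀ (u : ↥(Bs \ {b})) (v : ↥(Bsᶜ \ {t})),
      C' (Finset.incl (show Bs \ {b} ⊆ symmDiff Bs ({b, t} : Finset W) by
            intro a ha
            rw [Finset.mem_sdiff] at ha
            rw [Finset.mem_symmDiff]
            refine Or.inl ⟨ha.1, ?_⟩
            simp only [Finset.mem_insert, Finset.mem_singleton]
            push_neg
            refine ⟨by simpa using ha.2, ?_⟩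
            rintro rfl
            exact (Finset.mem_compl.mp ht) ha.1) u)
         (Finset.incl (show Bsᶜ \ {t} ⊆ (symmDiff Bs ({b, t} : Finset W))ᶜ by
            intro a ha
            rw [Finset.mem_sdiff, Finset.mem_compl] at ha
            rw [Finset.mem_compl, Finset.mem_symmDiff]
            push_neg
            constructor
            · intro h; exact absurd h ha.1
            · intro h
              rcases Finset.mem_insert.mp h with rfl | h'
              · exact hb
              · exact absurd (Finset.mem_singleton.mp h')
                  (by simpa using ha.2)) v) ≠ 0 →
      Qsum H q u.1 v.1 ≤ p v.1 - p u.1 := by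
  intro u v huv
  have ⟨_, _, h12, _, h22⟩ := hC'
  have htB : t ∉ Bs := Finset.mem_compl.mp ht
  have hu := Finset.mem_sdiff.mp u.2
  have hv := Finset.mem_sdiff.mp v.2
  have hub : u.1 ≠ b := by simpa using hu.2
  have hvt : v.1 ≠ t := by simpa using hv.2
  have hut : u.1 ≠ t := fun h => htB (h ▸ hu.1)
  have hvb : v.1 ≠ b := fun h => Finset.mem_compl.mp hv.1 (h ▸ hb)
  have hb' : b ∈ ({b, t} : Finset W) ∩ Bs := by simp [hb]
  have ht' : t ∈ ({b, t} : Finset W) \ Bs := by simp [htB]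
  have hu' : u.1 ∈ Bs \ ({b, t} : Finset W) := by simp [hu.1, hub, hut]
  have hv' : v.1 ∈ Bsᶜ \ ({b, t} : Finset W) := Finset.mem_sdiff.mpr ⟨hv.1, by simp [hvt, hvb]⟩
  have hβ := congrFun (congrFun h12 ⟨b, hb'⟩) ⟨v.1, hv'⟩
  have hδ := congrFun (congrFun h22 ⟨u.1, hu'⟩) ⟨v.1, hv'⟩
  simp only [Matrix.sub_apply, Matrix.mul_apply, Matrix.submatrix_apply, Finset.incl,
    sum_pair_sdiff hb ht'] at hβ hδ
  by_cases hCuv : Cs ⟨u.1, hu.1⟩ ⟨v.1, hv.1⟩ = 0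
  · simp only [Finset.incl] at huv
    rw [hδ, hCuv, zero_sub, neg_ne_zero] at huv
    have hCut := left_ne_zero_of_mul huv
    have hCbv : Cs ⟨b, hb⟩ ⟨v.1, hv.1⟩ ≠ 0 := by
      rw [← hβ]
      exact mul_ne_zero hbt (right_ne_zero_of_mul huv)
    have h₁ := hDF2 _ _ hCut
    have h₂ := hDF2 _ _ hCbv
    have h₃ := Qsum_le_add_of_not_crosses H q hq hq0 u.1 v.1
    simp only at h₁ h₂
    linarith
  · exact hDF2 _ _ hCuv
end

section
/- Suppose that (p, q) satisfies (DF2). Let X ⊆ V* be such that C*[X] is nonsingular, Σ_{v ∈ X∖B*} p(v) = Σ_{u ∈ X∩B*} p(u), and |X ∩ H| is even for every H ∈ Λ with q(H) > 0. Let C' be the matrix obtained from C* by pivoting around X, with row set B' = B* △ X and column set V* ∖ B'. Then (DF2) holds for C': for all u ∈ B' and v ∈ V*∖B' with C'_{uv} ≠ 0, one has p(v) − p(u) ≥ Q_{uv}. (This is the dual-feasibility preservation established for Step 2 of the augmentation procedure, where X plays the role of P*.) -/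
open Matrix

/-- The augmented matrix `[I | C]`: its columns are indexed by the whole ground set, and those
indexed by the row set form the identity matrix. -/
def Matrix.augment {K W : Type*} [Field K] [Fintype W] [DecidableEq W] (B : Finset W)
    (C : Matrix ↥B ↥(Bᶜ) K) : Matrix ↥B W K :=
  fun b w => if h : w ∈ B then if b.1 = w then 1 else 0 else C b ⟨w, Finset.mem_compl.mpr h⟩

theorem Matrix.augment_of_mem {K W : Type*} [Field K] [Fintype W] [DecidableEq W]
    {B : Finset W} (C : Matrix ↥B ↥(Bᶜ) K) (b : ↥B) {w : W} (h : w ∈ B) :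
    C.augment B b w = if b.1 = w then 1 else 0 :=
  dif_pos h

theorem Matrix.augment_of_notMem {K W : Type*} [Field K] [Fintype W] [DecidableEq W]
    {B : Finset W} (C : Matrix ↥B ↥(Bᶜ) K) (b : ↥B) {w : W} (h : w ∉ B) :
    C.augment B b w = C b ⟨w, Finset.mem_compl.mpr h⟩ :=
  dif_neg h

theorem Finset.sum_symmDiff_coe {W G : Type*} [DecidableEq W] [AddCommMonoid G]
    {B X : Finset W} (h₁ : X \ B ⊆ symmDiff B X) (h₂ : B \ X ⊆ symmDiff B X)
    (f : ↥(symmDiff B X) → G) :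
    ∑ u, f u = ∑ k, f (Finset.incl h₁ k) + ∑ k, f (Finset.incl h₂ k) := by
  let F : W → G := fun w => if h : w ∈ symmDiff B X then f ⟨w, h⟩ else 0
  have hF : ∀ u, f u = F u.1 := fun u => by simp [F, u.2]
  simp only [hF, Finset.incl]
  rw [Finset.sum_coe_sort (symmDiff B X) F, Finset.sum_coe_sort (X \ B) F,
    Finset.sum_coe_sort (B \ X) F, symmDiff_def, Finset.sup_eq_union,
    Finset.sum_union disjoint_sdiff_sdiff, add_comm]

theorem Finset.sum_symmDiff_sub_sum {W G : Type*} [DecidableEq W] [AddCommGroup G]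
    (B X : Finset W) (F : W → G) :
    ∑ w ∈ symmDiff B X, F w - ∑ w ∈ B, F w = ∑ w ∈ X \ B, F w - ∑ w ∈ X ∩ B, F w := by
  rw [symmDiff_def, Finset.sup_eq_union, Finset.sum_union disjoint_sdiff_sdiff,
    ← Finset.sum_inter_add_sum_sdiff B X F, Finset.inter_comm B X]
  abel

/-- A square matrix with nonzero determinant has a transversal of nonzero entries. -/
theorem Matrix.exists_perm_forall_ne_zero {K n : Type*} [Field K] [Fintype n] [DecidableEq n]
    {A : Matrix n n K} (hA : A.det ≠ 0) : ∃ σ : Equiv.Perm n, ∀ i, A (σ i) i ≠ 0 := by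
  rw [Matrix.det_apply'] at hA
  obtain ⟨σ, -, hσ⟩ := Finset.exists_ne_zero_of_sum_ne_zero hA
  refine ⟨σ, fun i hi => hσ (mul_eq_zero_of_right _ ?_)⟩
  exact Finset.prod_eq_zero (Finset.mem_univ i) hi

/-- The columns of `[I | C]` are expressed in the basis formed by the columns in `B △ X` with
the entries of `[I | C']` as coefficients. -/
theorem IsPivot.sum_augment_mul {K W : Type*} [Field K] [Fintype W] [DecidableEq W]
    {B X : Finset W} {C : Matrix ↥B ↥(Bᶜ) K}
    {C' : Matrix ↥(symmDiff B X) ↥((symmDiff B X)ᶜ) K} (h : IsPivot B X C C')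
    (b : ↥B) (w : W) :
    ∑ u : ↥(symmDiff B X), C.augment B b u.1 * C'.augment _ u w = C.augment B b w := by
  by_cases hw : w ∈ symmDiff B X
  · rw [Finset.sum_eq_single (⟨w, hw⟩ : ↥(symmDiff B X))]
    · simp [Matrix.augment, hw]
    · intro u _ hu
      have : u.1 ≠ w := fun e => hu (Subtype.ext e)
      simp [Matrix.augment, hw, this]
    · simp
  obtain ⟨h₁, h₂, h₃, h₄, h₅⟩ := h
  have h₆ := congrArg (· * C'.submatrix
    (Finset.incl (P := X \ B) (by grind [Finset.mem_symmDiff]))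
    (Finset.incl (P := X ∩ B) (by grind [Finset.mem_symmDiff]))) h₄
  simp only [Matrix.mul_assoc, h₁, Matrix.mul_one] at h₆
  rw [Finset.sum_symmDiff_coe (by grind [Finset.mem_symmDiff]) (by grind [Finset.mem_symmDiff])]
  have hl : ∀ k : ↥(X \ B), k.1 ∉ B := fun k => (Finset.mem_sdiff.mp k.2).2
  have hr : ∀ k : ↥(B \ X), k.1 ∈ B := fun k => (Finset.mem_sdiff.mp k.2).1
  simp only [Matrix.augment_of_notMem _ _ hw, Finset.incl, Matrix.augment_of_notMem C b (hl _),
    Matrix.augment_of_mem C b (hr _)]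
  obtain ⟨b, hb⟩ := b
  by_cases hbX : b ∈ X
  · have hne : ∀ k : ↥(B \ X), b ≠ k.1 := by grind
    simp only [hne, if_false, zero_mul, Finset.sum_const_zero, add_zero]
    by_cases hwB : w ∈ B
    · have hwX : w ∈ X := by grind [Finset.mem_symmDiff]
      have := congrFun (congrFun h₁ ⟨b, by grind⟩) ⟨w, by grind⟩
      simpa [Matrix.mul_apply, Finset.incl, Matrix.augment_of_mem _ _ hwB,
        Matrix.one_apply] using this
    · have hwX : w ∉ X := by grind [Finset.mem_symmDiff]
      have := congrFun (congrFun h₃ ⟨b, by grind⟩) ⟨w, by grind [Finset.mem_compl]⟩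
      simpa [Matrix.mul_apply, Finset.incl, Matrix.augment_of_notMem _ _ hwB] using this
  · have hs : ∀ f : ↥(B \ X) → K, ∑ k : ↥(B \ X), (if b = k.1 then (1 : K) else 0) * f k
        = f ⟨b, by grind⟩ := by
      intro f
      rw [Finset.sum_eq_single (⟨b, by grind⟩ : ↥(B \ X))]
      · simp
      · intro k _ hk
        have : b ≠ k.1 := fun e => hk (Subtype.ext e.symm)
        simp [this]
      · simp
    rw [hs (fun k => C' ⟨k.1, _⟩ _)]
    by_cases hwB : w ∈ B
    · have hwX : w ∈ X := by grind [Finset.mem_symmDiff]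
      have hbw : b ≠ w := by grind
      have := congrFun (congrFun h₆ ⟨b, by grind⟩) ⟨w, by grind⟩
      simp only [Matrix.neg_apply, Matrix.mul_apply, Matrix.submatrix_apply,
        Finset.incl] at this
      simp only [neg_mul, Finset.sum_neg_distrib] at this
      rw [this, add_neg_cancel, Matrix.augment_of_mem _ _ hwB, if_neg hbw]
    · have hwX : w ∉ X := by grind [Finset.mem_symmDiff]
      have := congrFun (congrFun h₅ ⟨b, by grind⟩) ⟨w, by grind [Finset.mem_compl]⟩
      simp only [Matrix.sub_apply, Matrix.mul_apply, Matrix.submatrix_apply,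
        Finset.incl] at this
      rw [this, add_sub_cancel, Matrix.augment_of_notMem _ _ hwB]

/-- A nonzero entry `(u, v)` of the pivoted matrix yields a bijection from `B` onto
`(B △ X) - u + v` along nonzero entries of `[I | C]`. -/
theorem IsPivot.exists_equiv {K W : Type*} [Field K] [Fintype W] [DecidableEq W]
    {B X : Finset W} {C : Matrix ↥B ↥(Bᶜ) K}
    {C' : Matrix ↥(symmDiff B X) ↥((symmDiff B X)ᶜ) K} (h : IsPivot B X C C')
    (hX : (csub B C X).Nonsing) (u : ↥(symmDiff B X)) (v : ↥((symmDiff B X)ᶜ))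
    (huv : C' u v ≠ 0) :
    ∃ σ : ↥B ≃ ↥(symmDiff B X),
      ∀ b, C.augment B b (Function.update Subtype.val u v.1 (σ b)) ≠ 0 := by
  obtain ⟨e, -⟩ := hX
  have hcard : (X ∩ B).card = (X \ B).card := by
    simpa only [Fintype.card_coe] using Fintype.card_congr e
  have hcard' : B.card = (symmDiff B X).card := by
    rw [symmDiff_def, Finset.sup_eq_union, Finset.card_union_of_disjoint disjoint_sdiff_sdiff,
      ← hcard, Finset.inter_comm, Finset.card_sdiff_add_card_inter]
  let τ : ↥(symmDiff B X) ≃ ↥B := Fintype.equivOfCardEq (by simpa using hcard'.symm)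
  let A : Matrix ↥(symmDiff B X) ↥(symmDiff B X) K := fun i j => C.augment B (τ i) j.1
  let D : Matrix ↥(symmDiff B X) ↥(symmDiff B X) K := fun i j => C'.augment _ i (τ j).1
  have hAD : A * D = 1 := by
    ext i j
    rw [Matrix.mul_apply]
    refine (h.sum_augment_mul (τ i) (τ j).1).trans ?_
    simp [Matrix.augment, Matrix.one_apply]
  have hA : A.det ≠ 0 := (Matrix.isUnit_det_of_right_inverse hAD).ne_zero
  have hv : v.1 ∉ symmDiff B X := Finset.mem_compl.mp v.2
  have hcol : A *ᵥ (fun w => C' w v) = fun i => C.augment B (τ i) v.1 := by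
    ext i
    rw [← h.sum_augment_mul (τ i) v.1]
    simp [Matrix.mulVec, dotProduct, A, Matrix.augment, hv]
  have hdet : (A.updateCol u (fun i => C.augment B (τ i) v.1)).det ≠ 0 := by
    rw [← Matrix.cramer_apply, ← hcol, Matrix.cramer_eq_adjugate_mulVec, Matrix.mulVec_mulVec,
      Matrix.adjugate_mul, Matrix.smul_mulVec, Matrix.one_mulVec]
    exact mul_ne_zero hA huv
  obtain ⟨σ, hσ⟩ := Matrix.exists_perm_forall_ne_zero hdet
  refine ⟨(σ.trans τ).symm, fun b => ?_⟩
  obtain ⟨j, rfl⟩ := (σ.trans τ).surjective b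
  have := hσ j
  rw [Equiv.symm_apply_apply]
  by_cases hj : j = u
  · subst hj
    simpa [Matrix.updateCol_apply] using this
  · rw [Matrix.updateCol_ne hj] at this
    simpa [hj] using this

/-- Change of a total weight when `B` is replaced by `(B △ X) - u + v`. -/
theorem Finset.sum_update_val_sub_sum {W G : Type*} [DecidableEq W] [AddCommGroup G]
    {B X : Finset W} (σ : ↥B ≃ ↥(symmDiff B X)) (u : ↥(symmDiff B X)) (v : W) (F : W → G) :
    ∑ b, F (Function.update Subtype.val u v (σ b)) - ∑ b : ↥B, F b.1
      = F v - F u.1 + (∑ w ∈ X \ B, F w - ∑ w ∈ X ∩ B, F w) := by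
  rw [σ.sum_comp (fun w => F (Function.update Subtype.val u v w)),
    ← Finset.sum_symmDiff_sub_sum, Finset.sum_coe_sort B F,
    ← Finset.sum_coe_sort (symmDiff B X) F,
    Fintype.sum_eq_add_sum_compl u, Fintype.sum_eq_add_sum_compl u (fun w => F w.1),
    Function.update_self]
  have : ∀ w ∈ ({u}ᶜ : Finset _), F (Function.update Subtype.val u v w) = F w.1 := by
    intro w hw
    rw [Function.update_of_ne (by simpa using hw)]
  rw [Finset.sum_congr rfl this]
  abel

theorem Qsum_eq_sum_ite {W I : Type*} [DecidableEq W] [Fintype I] (H : I → Finset W)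
    (q : I → ℝ) (u v : W) : Qsum H q u v = ∑ i, if crosses (H i) u v then q i else 0 :=
  Finset.sum_filter _ _

/-- A pair crossing a set that meets `X` evenly forces a crossing of that set along any
bijection from `B` onto `(B △ X) - u + v`. -/
theorem exists_crosses_of_even {W : Type*} [DecidableEq W] {B X S : Finset W}
    (σ : ↥B ≃ ↥(symmDiff B X)) (u : ↥(symmDiff B X)) (v : W) (hS : Even (X ∩ S).card)
    (h : crosses S u.1 v) :
    ∃ b : ↥B, crosses S b.1 (Function.update Subtype.val u v (σ b)) := by
  by_contra! hno
  let F : W → ZMod 2 := fun w => if w ∈ S then 1 else 0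
  have hF : ∀ b : ↥B, F (Function.update Subtype.val u v (σ b)) = F b.1 := by
    intro b
    have := hno b
    unfold crosses at this
    have hiff : Function.update Subtype.val u v (σ b) ∈ S ↔ b.1 ∈ S := by tauto
    simp only [F, hiff]
  have key := Finset.sum_update_val_sub_sum σ u v F
  have hsum : ∑ w ∈ X ∩ B, F w + ∑ w ∈ X \ B, F w = 0 := by
    rw [Finset.sum_inter_add_sum_sdiff]
    simpa [F, Finset.sum_boole, Finset.filter_mem_eq_inter, ZMod.natCast_eq_zero_iff_even]
      using hS
  rw [Finset.sum_congr rfl (fun b _ => hF b), sub_self, CharTwo.sub_eq_add (∑ w ∈ X \ B, F w),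
    add_comm (∑ w ∈ X \ B, F w), hsum, add_zero] at key
  rcases h with ⟨hu, hv⟩ | ⟨hv, hu⟩ <;> simp [F, hu, hv] at key

/-- **Dual feasibility is preserved by pivoting around a balanced set (augmentation,
Step 2).**  Suppose `(p, q)` satisfies (DF2), with `q ≥ 0`.  Let `X ⊆ V*` be such that
`C*[X]` is nonsingular, `Σ_{v ∈ X∖B*} p v = Σ_{u ∈ X∩B*} p u`, and `|X ∩ H|` is even for
every blossom `H` with `q H > 0`.  Let `C'` be obtained from `C*` by pivoting around `X`,
with row set `B' = B* △ X` and column set `V* ∖ B'`.  Then (DF2) holds for `C'`. -/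
theorem dualFeasible_after_pivot {K W I : Type*} [Field K] [Fintype W] [DecidableEq W]
    [Fintype I]
    (Bs : Finset W) (Cs : Matrix ↥Bs ↥(Bsᶜ) K)
    (H : I → Finset W) (q : I → ℝ) (hq : ∀ i, 0 ≤ q i) (p : W → ℝ)
    (hDF2 : DF2 Bs Cs H q p)
    (X : Finset W) (hXns : Matrix.Nonsing (csub Bs Cs X))
    (hbal : ∑ v ∈ X \ Bs, p v = ∑ u ∈ X ∩ Bs, p u)
    (heven : ∀ i, 0 < q i → Even ((X ∩ H i).card))
    (C' : Matrix ↥(symmDiff Bs X) ↥((symmDiff Bs X)ᶜ) K)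
    (hC' : IsPivot Bs X Cs C') :
    ∀ (u : ↥(symmDiff Bs X)) (v : ↥((symmDiff Bs X)ᶜ)),
      C' u v ≠ 0 → Qsum H q u.1 v.1 ≤ p v.1 - p u.1 := by
  intro u v huv
  obtain ⟨σ, hσ⟩ := hC'.exists_equiv hXns u v huv
  have hedge : ∀ b : ↥Bs, Qsum H q b.1 (Function.update Subtype.val u v.1 (σ b))
      ≤ p (Function.update Subtype.val u v.1 (σ b)) - p b.1 := by
    intro b
    have hb := hσ b
    generalize Function.update Subtype.val u v.1 (σ b) = w at hb ⊢
    by_cases hw : w ∈ Bs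
    · have hbw : b.1 = w := by
        by_contra hne
        simp [Matrix.augment, hw, hne] at hb
      subst hbw
      simp [Qsum, crosses]
    · exact hDF2 b ⟨w, Finset.mem_compl.mpr hw⟩ (by simpa [Matrix.augment, hw] using hb)
  calc Qsum H q u.1 v.1
      ≤ ∑ b : ↥Bs, Qsum H q b.1 (Function.update Subtype.val u v.1 (σ b)) := by
        simp only [Qsum_eq_sum_ite]
        rw [Finset.sum_comm]
        refine Finset.sum_le_sum fun i _ => ?_
        have hnonneg : ∀ b ∈ Finset.univ, 0 ≤
            if crosses (H i) b.1 (Function.update Subtype.val u v.1 (σ b)) then q i else 0 :=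
          fun b _ => by split_ifs <;> simp [hq i]
        split_ifs with hc
        · rcases (hq i).eq_or_lt with h0 | hpos
          · simp [← h0]
          · obtain ⟨b, hb⟩ := exists_crosses_of_even σ u v.1 (heven i hpos) hc
            have := Finset.single_le_sum hnonneg (Finset.mem_univ b)
            rwa [if_pos hb] at this
        · exact Finset.sum_nonneg hnonneg
    _ ≤ ∑ b : ↥Bs, (p (Function.update Subtype.val u v.1 (σ b)) - p b.1) :=
        Finset.sum_le_sum fun b _ => hedge b
    _ = p v.1 - p u.1 := by
        rw [Finset.sum_sub_distrib, Finset.sum_update_val_sub_sum, hbal, sub_self, add_zero]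
end

section
/- Let K be a field and Φ an alternating matrix (Φᵀ = −Φ with zero diagonal) with entries in K[θ], indexed by a finite set W. If the support graph Γ of Φ, i.e., the graph on W with edges {u,v} such that Φ_{uv} ≠ 0, has no perfect matching, then det Φ = 0. If Γ has a perfect matching, then deg(det Φ) ≤ 2·max{ Σ_{{u,v} ∈ M} deg(Φ_{uv}) : M a perfect matching of Γ }. (This is the determinant form of the bound deg Pf Φ ≤ maximum weight of a perfect matching in the support graph, where edge {u,v} has weight deg Φ_{uv}.) -/
open Polynomial Matrix

open scoped Classical

namespace Equiv.Perm

variable {α : Type*}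

/-- The fixed-point-free involution that pairs each element of `S` with its image under `σ`. -/
theorem exists_involutive_of_alternating {σ : Perm α} {S : Set α}
    (hS : ∀ x, σ x ∈ S ↔ x ∉ S) :
    ∃ μ : α → α, Function.Involutive μ ∧ (∀ x, μ x ≠ x) ∧
      (∀ x ∈ S, μ x = σ x) ∧ ∀ x ∉ S, μ x = σ.symm x := by
  have hS' : ∀ x, σ.symm x ∈ S ↔ x ∉ S := fun x => by
    have := hS (σ.symm x)
    rw [Equiv.apply_symm_apply] at this
    tauto
  refine ⟨fun x => if x ∈ S then σ x else σ.symm x, fun x => ?_, fun x hx => ?_,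
    fun x hx => if_pos hx, fun x hx => if_neg hx⟩
  · by_cases hx : x ∈ S
    · simp [hx, hS]
    · simp [hx, hS']
  · by_cases h : x ∈ S
    · have := hS x
      simp only [h, if_true] at hx
      rw [hx] at this
      tauto
    · have := hS' x
      simp only [h, if_false] at hx
      rw [hx] at this
      tauto

variable [Fintype α] [DecidableEq α]

/-- The permutation obtained from `σ` by reversing the cycle through `x`. -/
noncomputable def reverseCycle (σ : Perm α) (x : α) : Perm α :=
  (σ.cycleOf x)⁻¹ * ((σ.cycleOf x)⁻¹ * σ)

theorem reverseCycle_apply_of_sameCycle {σ : Perm α} {x y : α} (h : σ.SameCycle x y) :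
    σ.reverseCycle x y = σ.symm y := by
  have h₁ : (σ.cycleOf x)⁻¹ (σ y) = y := by
    rw [inv_eq_iff_eq, h.cycleOf_apply]
  rw [reverseCycle, mul_apply, mul_apply, h₁, cycleOf_inv, (sameCycle_inv.2 h).cycleOf_apply,
    coe_inv]

theorem reverseCycle_apply_of_not_sameCycle {σ : Perm α} {x y : α} (h : ¬ σ.SameCycle x y) :
    σ.reverseCycle x y = σ y := by
  have h₁ : ¬ σ.SameCycle x (σ y) := by rwa [sameCycle_apply_right]
  rw [reverseCycle, mul_apply, mul_apply, cycleOf_inv,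
    cycleOf_apply_of_not_sameCycle (mt sameCycle_inv.1 h₁),
    cycleOf_apply_of_not_sameCycle (mt sameCycle_inv.1 h₁)]

theorem cycleOf_mul_of_disjoint_left {c d : Perm α} (h : c.Disjoint d) {y : α} (hy : d y = y) :
    (c * d).cycleOf y = c.cycleOf y :=
  cycleOf_mul_of_apply_right_eq_self h.commute y hy

theorem disjoint_cycleOf_inv_mul (σ : Perm α) (x : α) :
    (σ.cycleOf x).Disjoint ((σ.cycleOf x)⁻¹ * σ) := by
  intro y
  by_cases h : σ.SameCycle x y
  · right
    rw [mul_apply, inv_eq_iff_eq, h.cycleOf_apply]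
  · exact Or.inl (cycleOf_apply_of_not_sameCycle h)

theorem cycleOf_reverseCycle_of_sameCycle {σ : Perm α} {x y : α} (h : σ.SameCycle x y) :
    (σ.reverseCycle x).cycleOf y = (σ.cycleOf y)⁻¹ := by
  have hd := disjoint_cycleOf_inv_mul σ x
  have hy : ((σ.cycleOf x)⁻¹ * σ) y = y := by
    rw [mul_apply, inv_eq_iff_eq, h.cycleOf_apply]
  have h₁ : σ.cycleOf y = (σ.cycleOf x).cycleOf y := by
    rw [← cycleOf_mul_of_disjoint_left hd hy, mul_inv_cancel_left]
  rw [reverseCycle, cycleOf_mul_of_disjoint_left hd.inv_left hy, h₁]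
  convert! (cycleOf_inv (σ.cycleOf x) y).symm

theorem cycleOf_reverseCycle_of_not_sameCycle {σ : Perm α} {x y : α} (h : ¬ σ.SameCycle x y) :
    (σ.reverseCycle x).cycleOf y = σ.cycleOf y := by
  have hd := (disjoint_cycleOf_inv_mul σ x).symm
  have hy : σ.cycleOf x y = y := cycleOf_apply_of_not_sameCycle h
  have h₁ : σ.cycleOf y = ((σ.cycleOf x)⁻¹ * σ).cycleOf y := by
    rw [← cycleOf_mul_of_disjoint_left hd hy, hd.commute.eq, mul_inv_cancel_left]
  rw [reverseCycle, ← hd.inv_right.commute.eq,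
    cycleOf_mul_of_disjoint_left hd.inv_right (by rw [inv_eq_iff_eq, hy]), h₁]

theorem orderOf_cycleOf_reverseCycle (σ : Perm α) (x y : α) :
    orderOf ((σ.reverseCycle x).cycleOf y) = orderOf (σ.cycleOf y) := by
  by_cases h : σ.SameCycle x y
  · rw [cycleOf_reverseCycle_of_sameCycle h, orderOf_inv]
  · rw [cycleOf_reverseCycle_of_not_sameCycle h]

theorem reverseCycle_reverseCycle (σ : Perm α) (x : α) :
    (σ.reverseCycle x).reverseCycle x = σ := by
  rw [reverseCycle, cycleOf_reverseCycle_of_sameCycle (SameCycle.refl σ x), reverseCycle]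
  group

theorem sign_reverseCycle (σ : Perm α) (x : α) :
    sign (σ.reverseCycle x) = sign σ := by
  rw [reverseCycle, sign_mul, sign_mul, ← mul_assoc, Int.units_mul_self, one_mul]

theorem reverseCycle_ne_self {σ : Perm α} {x : α} (hx : σ x ≠ x)
    (ho : Odd (orderOf (σ.cycleOf x))) : σ.reverseCycle x ≠ σ := by
  intro h
  rw [reverseCycle, ← mul_assoc, mul_eq_right, ← sq, inv_pow, inv_eq_one] at h
  have h₁ : orderOf (σ.cycleOf x) = 1 := by
    have h₂ := (Nat.dvd_prime Nat.prime_two).1 (orderOf_dvd_of_pow_eq_one h)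
    rcases h₂ with h₂ | h₂
    · exact h₂
    · rw [h₂] at ho
      exact absurd ho (by decide)
  exact hx ((cycleOf_eq_one_iff σ).1 (orderOf_eq_one_iff.1 h₁))

/-- A permutation all of whose cycles have even length alternates between two colours. -/
theorem exists_alternating_of_even_cycles {σ : Perm α}
    (h : ∀ x, Even (orderOf (σ.cycleOf x))) :
    ∃ S : Set α, ∀ x, σ x ∈ S ↔ x ∉ S := by
  have hr : ∀ x, ∃ k : ℤ, (σ ^ k) (Quotient.out (Quotient.mk (SameCycle.setoid σ) x)) = x :=
    fun x => Quotient.mk_out (s := SameCycle.setoid σ) x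
  choose k hk using hr
  have hmoved : ∀ x, σ x ≠ x := fun x hx => by
    have := h x
    rw [(cycleOf_eq_one_iff σ).2 hx, orderOf_one] at this
    exact absurd this (by decide)
  refine ⟨{x | Even (k x)}, fun x => ?_⟩
  have hq : Quotient.mk (SameCycle.setoid σ) (σ x) = Quotient.mk (SameCycle.setoid σ) x :=
    Quotient.sound (s := SameCycle.setoid σ) (sameCycle_apply_left.2 (SameCycle.refl σ x))
  have h₁ := hk (σ x)
  have h₂ := hk x
  rw [hq] at h₁
  set r := Quotient.out (Quotient.mk (SameCycle.setoid σ) x)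
  have h₃ : (σ ^ (k (σ x) - (k x + 1))) r = r := by
    rw [sub_eq_neg_add, _root_.zpow_add, mul_apply, h₁, _root_.zpow_neg, inv_eq_iff_eq, add_comm, _root_.zpow_add,
      mul_apply, h₂, zpow_one]
  have hmem : r ∈ (σ.cycleOf r).support :=
    (mem_support_cycleOf_iff' (hmoved r)).2 (SameCycle.refl σ r)
  rw [(isCycleOn_support_cycleOf σ r).zpow_apply_eq hmem,
    ← (isCycle_cycleOf σ (hmoved r)).orderOf] at h₃
  have h₄ : Even (k (σ x) - (k x + 1)) :=
    even_iff_two_dvd.2 ((Int.natCast_dvd_natCast.2 (h r).two_dvd).trans h₃)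
  simp only [Set.mem_ofPred_eq]
  rw [Int.even_sub, Int.even_add_one] at h₄
  exact h₄

end Equiv.Perm

namespace Matrix

open Equiv.Perm

variable {W R : Type*} [Fintype W] [DecidableEq W] [CommRing R]

/-- Reversing an odd cycle negates the corresponding product of entries of an alternating
matrix. -/
theorem prod_reverseCycle_of_odd {A : Matrix W W R} (hskew : ∀ i j, A i j = -A j i)
    {σ : Equiv.Perm W} {x : W} (hx : σ x ≠ x) (ho : Odd (orderOf (σ.cycleOf x))) :
    ∏ i, A (σ.reverseCycle x i) i = -∏ i, A (σ i) i := by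
  have hmem : ∀ y, y ∈ (σ.cycleOf x).support ↔ σ.SameCycle x y :=
    fun y => mem_support_cycleOf_iff' hx
  rw [← Finset.prod_mul_prod_compl (σ.cycleOf x).support,
    ← Finset.prod_mul_prod_compl (σ.cycleOf x).support (fun i => A (σ i) i), ← neg_mul]
  congr 1
  · rw [(isCycle_cycleOf σ hx).orderOf] at ho
    calc ∏ i ∈ (σ.cycleOf x).support, A (σ.reverseCycle x i) i
        = ∏ i ∈ (σ.cycleOf x).support, A i (σ i) := by
          refine Finset.prod_bij' (fun i _ => σ.symm i) (fun i _ => σ i) ?_ ?_ ?_ ?_ ?_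
          · intro i hi
            rw [hmem] at hi ⊢
            exact sameCycle_symm_apply_right.2 hi
          · intro i hi
            rw [hmem] at hi ⊢
            exact sameCycle_apply_right.2 hi
          · simp
          · simp
          · intro i hi
            rw [reverseCycle_apply_of_sameCycle ((hmem i).1 hi), Equiv.apply_symm_apply]
      _ = ∏ i ∈ (σ.cycleOf x).support, -A (σ i) i :=
          Finset.prod_congr rfl fun i _ => hskew _ _
      _ = -∏ i ∈ (σ.cycleOf x).support, A (σ i) i := by
          rw [Finset.prod_neg, ho.neg_one_pow, neg_one_mul]
  · refine Finset.prod_congr rfl fun i hi => ?_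
    rw [Finset.mem_compl, hmem] at hi
    rw [reverseCycle_apply_of_not_sameCycle hi]

/-- In the Leibniz expansion of the determinant of an alternating matrix, only the permutations
without odd cycles contribute. -/
theorem det_eq_sum_even_cycles {A : Matrix W W R} (hskew : ∀ i j, A i j = -A j i)
    (hdiag : ∀ i, A i i = 0) :
    A.det = ∑ σ : Equiv.Perm W with ∀ x, Even (orderOf (σ.cycleOf x)),
      Equiv.Perm.sign σ • ∏ i, A (σ i) i := by
  rw [det_apply, ← Finset.sum_filter_add_sum_filter_not Finset.univ
    (fun σ : Equiv.Perm W => ∀ x, Even (orderOf (σ.cycleOf x))), add_eq_left]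
  let O : Equiv.Perm W → Set W := fun σ => {x | Odd (orderOf (σ.cycleOf x))}
  have hO : ∀ σ x, O (σ.reverseCycle x) = O σ := fun σ x => by
    ext y
    simp only [O, Set.mem_ofPred_eq, orderOf_cycleOf_reverseCycle]
  have hne : ∀ σ ∈ (Finset.univ.filter fun σ : Equiv.Perm W =>
      ¬ ∀ x, Even (orderOf (σ.cycleOf x))), (O σ).Nonempty := fun σ hσ => by
    simpa [O, Set.Nonempty] using hσ
  have hfix : ∀ (σ : Equiv.Perm W) (x : W), σ x = x → ∏ i, A (σ i) i = 0 := fun σ x hx =>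
    Finset.prod_eq_zero (Finset.mem_univ x) (by rw [hx, hdiag])
  refine Finset.sum_involution (fun σ hσ => σ.reverseCycle (hne σ hσ).some) ?_ ?_ ?_ ?_
  · intro σ hσ
    have ho : Odd _ := (hne σ hσ).some_mem
    set x := (hne σ hσ).some
    by_cases hx : σ x = x
    · have hx' : σ.reverseCycle x x = x := by
        rw [reverseCycle_apply_of_sameCycle (SameCycle.refl σ x), Equiv.symm_apply_eq, hx]
      rw [hfix σ x hx, hfix _ x hx', smul_zero, smul_zero, add_zero]
    · rw [sign_reverseCycle, prod_reverseCycle_of_odd hskew hx ho, smul_neg, add_neg_cancel]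
  · intro σ hσ h0
    refine reverseCycle_ne_self (fun hx => h0 ?_) (hne σ hσ).some_mem
    rw [hfix σ _ hx, smul_zero]
  · intro σ hσ
    simpa [orderOf_cycleOf_reverseCycle] using hσ
  · intro σ hσ
    simp only [hO, reverseCycle_reverseCycle]

end Matrix

/-- A nonzero Leibniz term without odd cycles is dominated in degree by a perfect matching of the
support graph. -/
theorem exists_matching_degree_prod_le {K W : Type*} [Field K] [Fintype W]
    [DecidableEq W] {Φ : Matrix W W K[X]} (hskew : ∀ i j, Φ i j = -Φ j i) {σ : Equiv.Perm W}
    (hσ : ∀ x, Even (orderOf (σ.cycleOf x))) (h0 : ∏ i, Φ (σ i) i ≠ 0) :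
    ∃ μ : W → W, (Function.Involutive μ ∧ (∀ w, μ w ≠ w) ∧ ∀ w, Φ w (μ w) ≠ 0) ∧
      (∏ i, Φ (σ i) i).degree ≤ ∑ w, (Φ w (μ w)).degree := by
  obtain ⟨S, hS⟩ := Equiv.Perm.exists_alternating_of_even_cycles hσ
  obtain ⟨μ, hμi, hμf, hμ, hμ'⟩ := Equiv.Perm.exists_involutive_of_alternating hS
  obtain ⟨ν, hνi, hνf, hν, hν'⟩ := Equiv.Perm.exists_involutive_of_alternating
    (S := Sᶜ) (σ := σ) fun x => not_congr (hS x)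
  have hne : ∀ i, Φ (σ i) i ≠ 0 := fun i => Finset.prod_ne_zero_iff.1 h0 i (Finset.mem_univ i)
  have hne₁ : ∀ i, Φ i (σ i) ≠ 0 := fun i => by
    rw [hskew, neg_ne_zero]
    exact hne i
  have hne₂ : ∀ i, Φ i (σ.symm i) ≠ 0 := fun i => by
    simpa using hne (σ.symm i)
  have hμ0 : ∀ w, Φ w (μ w) ≠ 0 := fun w => by
    by_cases hw : w ∈ S
    · rw [hμ w hw]; exact hne₁ w
    · rw [hμ' w hw]; exact hne₂ w
  have hν0 : ∀ w, Φ w (ν w) ≠ 0 := fun w => by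
    by_cases hw : w ∈ S
    · rw [hν' w (not_not.2 hw)]; exact hne₂ w
    · rw [hν w hw]; exact hne₁ w
  have hcast : ∀ f : W → K[X], (∀ w, f w ≠ 0) →
      ∑ w, (f w).degree = ((∑ w, (f w).natDegree : ℕ) : WithBot ℕ) := fun f hf => by
    rw [Nat.cast_sum]
    exact Finset.sum_congr rfl fun w _ => degree_eq_natDegree (hf w)
  have hsum : ∑ w, (Φ w (μ w)).natDegree + ∑ w, (Φ w (ν w)).natDegree =
      ∑ w, (Φ (σ w) w).natDegree + ∑ w, (Φ (σ w) w).natDegree := by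
    have h₁ : ∑ w, (Φ w (σ.symm w)).natDegree = ∑ w, (Φ (σ w) w).natDegree := by
      rw [← Equiv.sum_comp σ]
      simp
    have h₂ : ∑ w, (Φ w (σ w)).natDegree = ∑ w, (Φ (σ w) w).natDegree :=
      Finset.sum_congr rfl fun w _ => by rw [hskew, natDegree_neg]
    nth_rewrite 1 [← h₂]
    rw [← h₁, ← Finset.sum_add_distrib, ← Finset.sum_add_distrib]
    refine Finset.sum_congr rfl fun w _ => ?_
    by_cases hw : w ∈ S
    · rw [hμ w hw, hν' w (not_not.2 hw)]
    · rw [hμ' w hw, hν w hw, add_comm]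
  rw [degree_prod, hcast _ hne]
  rcases le_total (∑ w, (Φ w (μ w)).natDegree) (∑ w, (Φ w (ν w)).natDegree) with h | h
  · refine ⟨ν, ⟨hνi, hνf, hν0⟩, ?_⟩
    rw [hcast _ hν0, Nat.cast_le]
    lia
  · refine ⟨μ, ⟨hμi, hμf, hμ0⟩, ?_⟩
    rw [hcast _ hμ0, Nat.cast_le]
    lia

/-- **Pfaffian degree bound, determinant form.**
Let `Φ` be an alternating matrix (`Φᵀ = -Φ` with zero diagonal) with entries in `K[θ]`,
indexed by a finite set `W`.  A perfect matching of the support graph of `Φ` is encoded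
as a fixed-point-free involution `μ : W → W` with `Φ w (μ w) ≠ 0` for all `w`; note that
for such a matching `M`, `Σ_w deg (Φ w (μ w)) = 2 · Σ_{{u,v} ∈ M} deg (Φ u v)`.
If the support graph has no perfect matching, then `det Φ = 0`; if it has one, then
`deg (det Φ) ≤ 2 · max { Σ_{{u,v} ∈ M} deg (Φ u v) : M a perfect matching }`. -/
theorem degree_det_alternating_le_matching {K W : Type*} [Field K] [Fintype W]
    [DecidableEq W] (Φ : Matrix W W (Polynomial K))
    (hskew : Φᵀ = -Φ) (hdiag : ∀ w, Φ w w = 0) :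
    ((¬ ∃ μ : W → W, Function.Involutive μ ∧ (∀ w, μ w ≠ w) ∧ ∀ w, Φ w (μ w) ≠ 0) →
        Φ.det = 0) ∧
    ((∃ μ : W → W, Function.Involutive μ ∧ (∀ w, μ w ≠ w) ∧ ∀ w, Φ w (μ w) ≠ 0) →
        Φ.det.degree ≤
          (Finset.univ.filter (fun μ : W → W =>
              Function.Involutive μ ∧ (∀ w, μ w ≠ w) ∧ ∀ w, Φ w (μ w) ≠ 0)).sup
            (fun μ => ∑ w, (Φ w (μ w)).degree)) := by
  have hskew' : ∀ i j, Φ i j = -Φ j i := fun i j => congrFun (congrFun hskew j) i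
  rw [Matrix.det_eq_sum_even_cycles hskew' hdiag]
  refine ⟨fun h => Finset.sum_eq_zero fun σ hσ => ?_, fun _ => ?_⟩
  · by_contra h0
    obtain ⟨μ, hμ, -⟩ := exists_matching_degree_prod_le hskew' (Finset.mem_filter.1 hσ).2
      (right_ne_zero_of_smul h0)
    exact h ⟨μ, hμ⟩
  · refine (degree_sum_le _ _).trans (Finset.sup_le fun σ hσ => ?_)
    have hdeg : (Equiv.Perm.sign σ • ∏ i, Φ (σ i) i).degree = (∏ i, Φ (σ i) i).degree := by
      rcases Int.units_eq_one_or (Equiv.Perm.sign σ) with h | h <;> simp [h, Units.smul_def]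
    rw [hdeg]
    by_cases h0 : ∏ i, Φ (σ i) i = 0
    · rw [h0, degree_zero]
      exact bot_le
    · obtain ⟨μ, hμ, hle⟩ := exists_matching_degree_prod_le hskew' (Finset.mem_filter.1 hσ).2 h0
      exact hle.trans (Finset.le_sup (f := fun μ : W → W => ∑ w, (Φ w (μ w)).degree)
        (Finset.mem_filter.2 ⟨Finset.mem_univ μ, hμ⟩))
end
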